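/- arXiv:math/0409105 — 4 statements merged into one kernel-verified Lean document; each statement's English description precedes it below -/
import Mathlib

section
/- For all integers m ≥ 0 and n > m, there exists a natural number k such that the number of domino tilings of the odd holey square 𝓗°(m,n) equals 2^(n−m) · (2k+1)². -/
/-- Two cells of `ℤ × ℤ` are adjacent if they differ by `(1,0)` or `(0,1)`. -/
def Adjacent (a b : ℤ × ℤ) : Prop :=
  (a.1 = b.1 ∧ (a.2 = b.2 + 1 ∨ b.2 = a.2 + 1)) ∨
  (a.2 = b.2 ∧ (a.1 = b.1 + 1 ∨ b.1 = a.1 + 1))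

/-- `T` is a domino tiling of `R`: a partition of `R` into two-element sets of adjacent cells. -/
def IsDominoTiling (R : Set (ℤ × ℤ)) (T : Set (Set (ℤ × ℤ))) : Prop :=
  (∀ d ∈ T, ∃ a b, Adjacent a b ∧ d = {a, b}) ∧
  T.PairwiseDisjoint id ∧
  ⋃₀ T = R

/-- The number of domino tilings of `R`. -/
noncomputable def numTilings (R : Set (ℤ × ℤ)) : ℕ :=
  Nat.card {T : Set (Set (ℤ × ℤ)) // IsDominoTiling R T}

/-- The odd holey square `𝓗°(m,n)`: the `(2n+1) × (2n+1)` square with a centered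
`(2m+1) × (2m+1)` hole. -/
def oddHoleySquare (m n : ℕ) : Set (ℤ × ℤ) :=
  {q | 0 ≤ q.1 ∧ q.1 < 2 * n + 1 ∧ 0 ≤ q.2 ∧ q.2 < 2 * n + 1 ∧
    ¬((n : ℤ) - m ≤ q.1 ∧ q.1 ≤ (n : ℤ) + m ∧ (n : ℤ) - m ≤ q.2 ∧ q.2 ≤ (n : ℤ) + m)}

instance instDecAdj : DecidableRel Adjacent := fun a b => by unfold Adjacent; infer_instance

namespace HS

abbrev cc (v : ℤ × ℤ) : ℤ := v.1 - v.2
abbrev ss (v : ℤ × ℤ) : ℤ := v.1 + v.2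

def WF (R : Finset (ℤ × ℤ)) : Finset (ℤ × ℤ) := R.filter (fun v => (v.1 + v.2) % 2 = 0)
def BF (R : Finset (ℤ × ℤ)) : Finset (ℤ × ℤ) := R.filter (fun v => ¬ (v.1 + v.2) % 2 = 0)

lemma mem_WF {R : Finset (ℤ × ℤ)} {v : ℤ × ℤ} : v ∈ WF R ↔ v ∈ R ∧ (v.1 + v.2) % 2 = 0 := by
  simp [WF]
lemma mem_BF {R : Finset (ℤ × ℤ)} {v : ℤ × ℤ} : v ∈ BF R ↔ v ∈ R ∧ ¬ (v.1 + v.2) % 2 = 0 := by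
  simp [BF]

lemma adj_symm {a b : ℤ × ℤ} (h : Adjacent a b) : Adjacent b a := by
  unfold Adjacent at *; omega

lemma adj_par {a b : ℤ × ℤ} (h : Adjacent a b) :
    (a.1 + a.2) % 2 = 0 ↔ ¬ (b.1 + b.2) % 2 = 0 := by
  unfold Adjacent at h; omega

lemma adj_ne {a b : ℤ × ℤ} (h : Adjacent a b) : a ≠ b := by
  rintro rfl; unfold Adjacent at h; omega

lemma tiling_partner {R : Finset (ℤ × ℤ)} {T : Set (Set (ℤ × ℤ))}
    (hT : IsDominoTiling (R : Set (ℤ × ℤ)) T) :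
    ∃ p : ℤ × ℤ → ℤ × ℤ, ∀ v ∈ R, p v ∈ R ∧ p (p v) = v ∧ Adjacent v (p v) ∧
      ({v, p v} : Set (ℤ × ℤ)) ∈ T := by
  obtain ⟨h1, h2, h3⟩ := hT
  have hmem : ∀ d ∈ T, ∀ x ∈ d, x ∈ R := by
    intro d hd x hx
    have : x ∈ ⋃₀ T := ⟨d, hd, hx⟩
    rw [h3] at this
    exact_mod_cast this
  have ex : ∀ v, v ∈ R → ∃ u, Adjacent v u ∧ ({v, u} : Set (ℤ × ℤ)) ∈ T := by
    intro v hv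
    have : v ∈ ⋃₀ T := by rw [h3]; exact_mod_cast hv
    obtain ⟨d, hd, hvd⟩ := this
    obtain ⟨a, b, hab, rfl⟩ := h1 d hd
    rcases hvd with rfl | hvb
    · exact ⟨b, hab, hd⟩
    · have hvb : v = b := hvb
      subst hvb
      exact ⟨a, adj_symm hab, by rwa [Set.pair_comm]⟩
  have uniq : ∀ v u u', Adjacent v u → ({v, u} : Set (ℤ × ℤ)) ∈ T →
      ({v, u'} : Set (ℤ × ℤ)) ∈ T → u = u' := by
    intro v u u' ha hu hu'
    have : ({v, u} : Set (ℤ × ℤ)) = {v, u'} := by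
      by_contra hne
      have := h2 hu hu' hne
      have := Set.disjoint_left.mp this (show v ∈ ({v, u} : Set (ℤ × ℤ)) by simp)
      simp at this
    have h : u ∈ ({v, u'} : Set (ℤ × ℤ)) := by rw [← this]; simp
    rcases h with h | h
    · exact absurd h.symm (adj_ne ha)
    · exact h
  choose! p hp using ex
  refine ⟨p, fun v hv => ?_⟩
  have hpR : p v ∈ R := hmem _ (hp v hv).2 _ (by simp)
  refine ⟨hpR, ?_, (hp v hv).1, (hp v hv).2⟩
  refine uniq (p v) _ _ (hp _ hpR).1 (hp _ hpR).2 ?_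
  rw [Set.pair_comm]; exact (hp v hv).2

theorem tilings_card (R : Finset (ℤ × ℤ)) :
    numTilings (R : Set (ℤ × ℤ)) =
      Nat.card {σ : WF R ≃ BF R // ∀ w, Adjacent w.1 (σ w).1} := by
  symm
  unfold numTilings
  have key : ∀ σ : {σ : WF R ≃ BF R // ∀ w, Adjacent w.1 (σ w).1},
      IsDominoTiling (R : Set (ℤ × ℤ))
        (Set.range (fun w : WF R => ({w.1, (σ.1 w).1} : Set (ℤ × ℤ)))) := by
    rintro ⟨σ, hσ⟩
    refine ⟨?_, ?_, ?_⟩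
    · rintro d ⟨w, rfl⟩
      exact ⟨_, _, hσ w, rfl⟩
    · rintro d ⟨w, rfl⟩ d' ⟨w', rfl⟩ hne
      have hww : w ≠ w' := by rintro rfl; exact hne rfl
      have hw := (mem_WF.1 w.2).2
      have hw' := (mem_WF.1 w'.2).2
      have hb := (mem_BF.1 (σ w).2).2
      have hb' := (mem_BF.1 (σ w').2).2
      simp only [Function.onFun, id]
      rw [Set.disjoint_left]
      rintro x (rfl | hx) (h | h)
      · exact hww (Subtype.ext h)
      · have h : w.1 = (σ w').1 := h
        rw [h] at hw; exact hb' hw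
      · have hx : x = (σ w).1 := hx
        rw [← hx, h] at hb; exact hb hw'
      · have hx : x = (σ w).1 := hx
        have h : x = (σ w').1 := h
        exact hww (σ.injective (Subtype.ext (hx.symm.trans h)))
    · ext x
      simp only [Set.sUnion_range, Set.mem_iUnion, Set.mem_insert_iff, Set.mem_singleton_iff,
        Finset.mem_coe]
      constructor
      · rintro ⟨w, rfl | rfl⟩
        · exact (mem_WF.1 w.2).1
        · exact (mem_BF.1 (σ w).2).1
      · intro hx
        by_cases h : (x.1 + x.2) % 2 = 0
        · exact ⟨⟨x, mem_WF.2 ⟨hx, h⟩⟩, Or.inl rfl⟩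
        · exact ⟨σ.symm ⟨x, mem_BF.2 ⟨hx, h⟩⟩, Or.inr (by simp)⟩
  refine Nat.card_congr (Equiv.ofBijective (fun σ => ⟨_, key σ⟩) ⟨?_, ?_⟩)
  · rintro ⟨σ, hσ⟩ ⟨τ, hτ⟩ h
    have h' := congrArg Subtype.val h
    simp only at h'
    apply Subtype.ext
    ext1 w
    have hm : ({w.1, (σ w).1} : Set (ℤ × ℤ)) ∈
        Set.range (fun w : WF R => ({w.1, (τ w).1} : Set (ℤ × ℤ))) := by
      rw [← h']; exact ⟨w, rfl⟩
    obtain ⟨w', hw'⟩ := hm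
    simp only at hw'
    have e1 : w'.1 ∈ ({w.1, (σ w).1} : Set (ℤ × ℤ)) := by rw [← hw']; simp
    have e2 : (τ w').1 ∈ ({w.1, (σ w).1} : Set (ℤ × ℤ)) := by rw [← hw']; simp
    have e3 : w' = w := by
      rcases e1 with e1 | e1
      · exact Subtype.ext e1
      · exfalso
        have e1 : w'.1 = (σ w).1 := e1
        have := (mem_BF.1 (σ w).2).2
        rw [← e1] at this
        exact this (mem_WF.1 w'.2).2
    subst e3
    rcases e2 with e2 | e2
    · exact absurd e2.symm (adj_ne (hτ w'))
    · exact Subtype.ext (Eq.symm e2)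
  · rintro ⟨T, hT⟩
    obtain ⟨p, hp⟩ := tiling_partner hT
    have a1 : ∀ w : WF R, p w.1 ∈ BF R := fun w =>
      mem_BF.2 ⟨(hp _ (mem_WF.1 w.2).1).1,
        (adj_par (hp _ (mem_WF.1 w.2).1).2.2.1).1 (mem_WF.1 w.2).2⟩
    have a2 : ∀ w : BF R, p w.1 ∈ WF R := fun w =>
      mem_WF.2 ⟨(hp _ (mem_BF.1 w.2).1).1,
        (adj_par (adj_symm (hp _ (mem_BF.1 w.2).1).2.2.1)).2 (mem_BF.1 w.2).2⟩
    let σ : WF R ≃ BF R :=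
      { toFun := fun w => ⟨p w.1, a1 w⟩
        invFun := fun b => ⟨p b.1, a2 b⟩
        left_inv := fun w => Subtype.ext (hp _ (mem_WF.1 w.2).1).2.1
        right_inv := fun w => Subtype.ext (hp _ (mem_BF.1 w.2).1).2.1 }
    have hσ : ∀ w, Adjacent w.1 (σ w).1 := fun w => (hp _ (mem_WF.1 w.2).1).2.2.1
    refine ⟨⟨σ, hσ⟩, Subtype.ext ?_⟩
    ext d
    simp only [Set.mem_range]
    constructor
    · rintro ⟨w, rfl⟩
      exact (hp _ (mem_WF.1 w.2).1).2.2.2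
    · intro hd
      have hd0 := hd
      obtain ⟨a, b, hab, rfl⟩ := hT.1 d hd
      have hmemR : ∀ x ∈ ({a, b} : Set (ℤ × ℤ)), x ∈ R := by
        intro x hx
        have : x ∈ ⋃₀ T := ⟨_, hd, hx⟩
        rw [hT.2.2] at this
        exact_mod_cast this
      have gen : ∀ x, x ∈ ({a, b} : Set (ℤ × ℤ)) → ({x, p x} : Set (ℤ × ℤ)) = {a, b} := by
        intro x hx
        by_contra hne
        have := hT.2.1 (hp x (hmemR x hx)).2.2.2 hd hne
        have := Set.disjoint_left.mp this (show x ∈ ({x, p x} : Set (ℤ × ℤ)) by simp)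
        exact this hx
      by_cases h : (a.1 + a.2) % 2 = 0
      · exact ⟨⟨a, mem_WF.2 ⟨hmemR a (by simp), h⟩⟩, gen a (by simp)⟩
      · refine ⟨⟨b, mem_WF.2 ⟨hmemR b (by simp), ?_⟩⟩, gen b (by simp)⟩
        have := adj_par hab
        tauto

def IsM (R : Finset (ℤ × ℤ)) (P : ℤ × ℤ → ℤ × ℤ) : Prop :=
  ∀ v ∈ R, P v ∈ R ∧ P (P v) = v ∧ Adjacent v (P v)

/-- strict lexicographic order by diagonal, then along the diagonal -/
def lt (u v : ℤ × ℤ) : Prop := cc u < cc v ∨ (cc u = cc v ∧ ss u < ss v)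

instance : DecidableRel lt := fun a b => by unfold lt; infer_instance

def idx (R : Finset (ℤ × ℤ)) (v : ℤ × ℤ) : ℕ :=
  (R.filter (fun u => cc u = cc v ∧ ss v < ss u)).card

def U (P : ℤ × ℤ → ℤ × ℤ) (v : ℤ × ℤ) : ℕ := if cc (P v) = cc v + 1 then 1 else 0

def q (P : ℤ × ℤ → ℤ × ℤ) (u v : ℤ × ℤ) : ℕ :=
  if cc u = cc v ∧ ss u < ss v ∧ cc (P u) = cc u + 1 ∧ ¬ cc (P v) = cc v + 1 then 1 else 0

lemma adj_cc {a b : ℤ × ℤ} (h : Adjacent a b) :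
    (cc b = cc a + 1 ∨ cc b = cc a - 1) ∧ (ss b = ss a + 1 ∨ ss b = ss a - 1) := by
  unfold Adjacent at h; simp only [cc, ss]; omega

lemma ext_cs {a b : ℤ × ℤ} (h1 : cc a = cc b) (h2 : ss a = ss b) : a = b := by
  simp only [cc, ss] at *
  ext <;> omega

lemma sum_split (R : Finset (ℤ × ℤ)) (f : ℤ × ℤ → ℕ) :
    ∑ v ∈ R, f v = ∑ v ∈ WF R, f v + ∑ v ∈ BF R, f v := by
  unfold WF BF
  rw [Finset.sum_filter_add_sum_filter_not]

lemma IsM.memB {R : Finset (ℤ × ℤ)} {P : ℤ × ℤ → ℤ × ℤ} (h : IsM R P) {w : ℤ × ℤ}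
    (hw : w ∈ WF R) : P w ∈ BF R :=
  mem_BF.2 ⟨(h _ (mem_WF.1 hw).1).1, (adj_par (h _ (mem_WF.1 hw).1).2.2).1 (mem_WF.1 hw).2⟩

lemma IsM.memW {R : Finset (ℤ × ℤ)} {P : ℤ × ℤ → ℤ × ℤ} (h : IsM R P) {w : ℤ × ℤ}
    (hw : w ∈ BF R) : P w ∈ WF R :=
  mem_WF.2 ⟨(h _ (mem_BF.1 hw).1).1,
    (adj_par (adj_symm (h _ (mem_BF.1 hw).1).2.2)).2 (mem_BF.1 hw).2⟩

lemma IsM.sumB {R : Finset (ℤ × ℤ)} {P : ℤ × ℤ → ℤ × ℤ} (h : IsM R P) (f : ℤ × ℤ → ℕ) :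
    ∑ b ∈ BF R, f b = ∑ w ∈ WF R, f (P w) := by
  symm
  refine Finset.sum_bij' (fun w _ => P w) (fun b _ => P b) (fun w hw => h.memB hw)
    (fun w hw => h.memW hw) (fun w hw => (h _ (mem_WF.1 hw).1).2.1)
    (fun w hw => (h _ (mem_BF.1 hw).1).2.1) (fun _ _ => rfl)

lemma inv_eq {R : Finset (ℤ × ℤ)} {P : ℤ × ℤ → ℤ × ℤ} (h : IsM R P) :
    (∑ i ∈ WF R, ∑ j ∈ WF R, if lt i j ∧ lt (P j) (P i) then 1 else 0)
      = ∑ u ∈ R, ∑ v ∈ R, q P u v := by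
  have e1 : ∑ u ∈ R, ∑ v ∈ R, q P u v = ∑ u ∈ WF R, ∑ v ∈ WF R, q P u v +
      ∑ u ∈ BF R, ∑ v ∈ BF R, q P u v := by
    rw [sum_split]
    congr 1
    · refine Finset.sum_congr rfl fun u hu => ?_
      rw [sum_split, Nat.add_eq_left]
      refine Finset.sum_eq_zero fun v hv => ?_
      have := (mem_WF.1 hu).2
      have := (mem_BF.1 hv).2
      unfold q; rw [if_neg]; simp only [cc, ss]; omega
    · refine Finset.sum_congr rfl fun u hu => ?_
      rw [sum_split, Nat.add_eq_right]
      refine Finset.sum_eq_zero fun v hv => ?_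
      have := (mem_BF.1 hu).2
      have := (mem_WF.1 hv).2
      unfold q; rw [if_neg]; simp only [cc, ss]; omega
  rw [e1, h.sumB]
  simp_rw [h.sumB]
  rw [Finset.sum_comm (s := WF R) (t := WF R) (f := fun i j => q P (P i) (P j)),
    ← Finset.sum_add_distrib]
  refine Finset.sum_congr rfl fun i hi => ?_
  rw [← Finset.sum_add_distrib]
  refine Finset.sum_congr rfl fun j hj => ?_
  have hi' := h _ (mem_WF.1 hi).1
  have hj' := h _ (mem_WF.1 hj).1
  have pi := (mem_WF.1 hi).2
  have pj := (mem_WF.1 hj).2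
  have ai := adj_cc hi'.2.2
  have aj := adj_cc hj'.2.2
  have hinj : cc (P i) = cc (P j) → ss (P i) = ss (P j) → cc i = cc j ∧ ss i = ss j := by
    intro h1 h2
    have := congrArg P (ext_cs h1 h2)
    rw [hi'.2.1, hj'.2.1] at this
    rw [this]; exact ⟨rfl, rfl⟩
  unfold q lt
  rw [hi'.2.1, hj'.2.1]
  have pi' : (ss i) % 2 = 0 := pi
  have pj' : (ss j) % 2 = 0 := pj
  have pi2 : (cc i - ss i) % 2 = 0 := by simp only [cc, ss]; omega
  have pj2 : (cc j - ss j) % 2 = 0 := by simp only [cc, ss]; omega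
  clear e1 hi' hj' pi pj hi hj
  obtain ⟨a1, a2⟩ := ai
  obtain ⟨b1, b2⟩ := aj
  split_ifs <;> first | rfl | (exfalso; omega)

/-- number of up-matched cells on a diagonal -/
def kk (R : Finset (ℤ × ℤ)) (P : ℤ × ℤ → ℤ × ℤ) (c : ℤ) : ℕ := ∑ v ∈ R with cc v = c, U P v

lemma kk_rec {R : Finset (ℤ × ℤ)} {P : ℤ × ℤ → ℤ × ℤ} (h : IsM R P) (c : ℤ) :
    kk R P c + kk R P (c + 1) = (R.filter (fun v => cc v = c + 1)).card := by
  have : kk R P c = ∑ v ∈ R with cc v = c + 1, (1 - U P v) := by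
    unfold kk U
    have e1 : ∀ v ∈ R.filter (fun v => cc v = c + 1),
        (1 - if cc (P v) = cc v + 1 then 1 else 0) = if cc (P v) = cc v - 1 then 1 else 0 := by
      intro v hv
      have := (adj_cc (h v (Finset.mem_filter.1 hv).1).2.2).1
      split_ifs <;> omega
    rw [Finset.sum_congr rfl e1, Finset.sum_boole, Finset.sum_boole, Finset.filter_filter,
      Finset.filter_filter]
    simp only [Nat.cast_id]
    refine Finset.card_bij' (fun w _ => P w) (fun b _ => P b) ?_ ?_ ?_ ?_
    · intro v hv
      simp only [Finset.mem_filter] at hv ⊢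
      have := h v hv.1
      rw [this.2.1]
      exact ⟨this.1, by omega, by omega⟩
    · intro v hv
      simp only [Finset.mem_filter] at hv ⊢
      have := h v hv.1
      rw [this.2.1]
      exact ⟨this.1, by omega, by omega⟩
    · intro v hv
      simp only [Finset.mem_filter] at hv
      exact (h v hv.1).2.1
    · intro v hv
      simp only [Finset.mem_filter] at hv
      exact (h v hv.1).2.1
  rw [this]
  unfold kk
  rw [← Finset.sum_add_distrib, Finset.card_eq_sum_ones]
  refine Finset.sum_congr rfl fun v _ => ?_
  unfold U; split_ifs <;> rfl

lemma kk_eq {R : Finset (ℤ × ℤ)} {P Q : ℤ × ℤ → ℤ × ℤ} (h : IsM R P) (h' : IsM R Q) (c : ℤ) :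
    kk R P c = kk R Q c := by
  obtain ⟨c0, hc0⟩ : ∃ c0, ∀ v ∈ R, c0 ≤ cc v := by
    obtain ⟨c0, hc0⟩ := (R.image cc).bddBelow
    exact ⟨c0, fun v hv => hc0 (by simpa using ⟨v.1, v.2, hv, rfl⟩)⟩
  have z : ∀ P c, c < c0 → kk R P c = 0 := by
    intro P c hc
    unfold kk
    rw [Finset.sum_eq_zero]
    intro v hv
    simp only [Finset.mem_filter] at hv
    have := hc0 v hv.1
    omega
  by_cases hc : c < c0
  · rw [z _ _ hc, z _ _ hc]
  · have : ∀ n : ℕ, kk R P (c0 - 1 + n) = kk R Q (c0 - 1 + n) := by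
      intro n
      induction n with
      | zero => rw [z _ _ (by simp), z _ _ (by simp)]
      | succ n ih =>
        have a := kk_rec h (c0 - 1 + n)
        have b := kk_rec h' (c0 - 1 + n)
        push_cast
        rw [← add_assoc]
        omega
    have := this (c - (c0 - 1)).toNat
    rwa [show c0 - 1 + ((c - (c0 - 1)).toNat : ℤ) = c by omega] at this

lemma kk_sq (R : Finset (ℤ × ℤ)) (P : ℤ × ℤ → ℤ × ℤ) :
    2 * (∑ u ∈ R, ∑ v ∈ R, if cc u = cc v ∧ ss u < ss v then U P u * U P v else 0)
      + ∑ u ∈ R, U P u = ∑ c ∈ R.image cc, kk R P c * kk R P c := by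
  have e1 : ∑ c ∈ R.image cc, kk R P c * kk R P c =
      ∑ u ∈ R, ∑ v ∈ R, if cc u = cc v then U P u * U P v else 0 := by
    rw [← Finset.sum_fiberwise_of_maps_to (s := R) (t := R.image cc) (g := cc)
      (fun v hv => Finset.mem_image_of_mem _ hv)]
    refine Finset.sum_congr rfl fun c _ => ?_
    unfold kk
    rw [Finset.sum_mul_sum]
    refine Finset.sum_congr rfl fun u hu => ?_
    simp only [Finset.mem_filter] at hu
    rw [Finset.sum_filter]
    refine Finset.sum_congr rfl fun v _ => ?_
    rw [hu.2]; simp only [eq_comm]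
  have e2 : (∑ u ∈ R, ∑ v ∈ R, if cc u = cc v then U P u * U P v else 0) =
      (∑ u ∈ R, ∑ v ∈ R, if cc u = cc v ∧ ss u < ss v then U P u * U P v else 0) +
      (∑ u ∈ R, ∑ v ∈ R, if cc v = cc u ∧ ss v < ss u then U P v * U P u else 0) +
      (∑ u ∈ R, ∑ v ∈ R, if u = v then U P u else 0) := by
    simp only [← Finset.sum_add_distrib]
    refine Finset.sum_congr rfl fun u _ => Finset.sum_congr rfl fun v _ => ?_
    by_cases huv : u = v
    · subst huv
      simp; unfold U; split_ifs <;> rfl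
    · have : ¬ (cc u = cc v ∧ ss u = ss v) := fun h => huv (ext_cs h.1 h.2)
      rw [if_neg huv, Nat.mul_comm (U P v)]
      generalize U P u * U P v = z
      generalize cc u = a at *
      generalize cc v = b at *
      generalize ss u = c at *
      generalize ss v = d at *
      split_ifs <;> omega
  rw [e1, e2, Finset.sum_comm (f := fun u v => if cc v = cc u ∧ ss v < ss u then _ else _)]
  have e3 : (∑ u ∈ R, ∑ v ∈ R, if u = v then U P u else 0) = ∑ u ∈ R, U P u := by
    refine Finset.sum_congr rfl fun u hu => ?_
    rw [Finset.sum_ite_eq]; simp [hu]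
  rw [e3]; omega

lemma sumU (R : Finset (ℤ × ℤ)) (P : ℤ × ℤ → ℤ × ℤ) :
    ∑ u ∈ R, U P u = ∑ c ∈ R.image cc, kk R P c := by
  rw [← Finset.sum_fiberwise_of_maps_to (s := R) (t := R.image cc) (g := cc)
      (fun v hv => Finset.mem_image_of_mem _ hv)]
  rfl

lemma q_sum (R : Finset (ℤ × ℤ)) (P : ℤ × ℤ → ℤ × ℤ) :
    ∑ u ∈ R, ∑ v ∈ R, q P u v +
      (∑ u ∈ R, ∑ v ∈ R, if cc u = cc v ∧ ss u < ss v then U P u * U P v else 0)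
      = ∑ u ∈ R, U P u * idx R u := by
  simp only [← Finset.sum_add_distrib]
  refine Finset.sum_congr rfl fun u _ => ?_
  unfold idx
  rw [Finset.card_filter, Finset.mul_sum]
  refine Finset.sum_congr rfl fun v _ => ?_
  unfold q U
  split_ifs <;> omega

/-- edge sign -/
def om (R : Finset (ℤ × ℤ)) (w b : ℤ × ℤ) : ℤ :=
  (if cc w ≤ 0 then (if cc b = cc w + 1 then (-1) ^ idx R w else 1)
    else (if cc b = cc w + 1 then 1 else (-1) ^ idx R w)) *
  (if cc b ≤ 0 then (if cc w = cc b + 1 then (-1) ^ idx R b else 1)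
    else (if cc w = cc b + 1 then 1 else (-1) ^ idx R b))

def th (R : Finset (ℤ × ℤ)) (P : ℤ × ℤ → ℤ × ℤ) (w : ℤ × ℤ) : ℤ :=
  if cc w ≤ 0 then (if cc (P w) = cc w + 1 then (-1) ^ idx R w else 1)
    else (if cc (P w) = cc w + 1 then 1 else (-1) ^ idx R w)

lemma om_prod {R : Finset (ℤ × ℤ)} {P : ℤ × ℤ → ℤ × ℤ} (h : IsM R P) :
    ∏ w ∈ WF R, om R w (P w) =
      (-1) ^ (∑ u ∈ R, U P u * idx R u) * ∏ v ∈ R, (if cc v ≤ 0 then 1 else (-1) ^ idx R v) := by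
  have e1 : ∏ w ∈ WF R, om R w (P w) = ∏ v ∈ R, th R P v := by
    have : ∏ v ∈ R, th R P v = (∏ v ∈ WF R, th R P v) * ∏ v ∈ BF R, th R P v := by
      unfold WF BF
      rw [Finset.prod_filter_mul_prod_filter_not]
    rw [this]
    have : ∏ v ∈ BF R, th R P v = ∏ v ∈ WF R, th R P (P v) := by
      symm
      refine Finset.prod_bij' (fun w _ => P w) (fun b _ => P b) (fun w hw => h.memB hw)
        (fun w hw => h.memW hw) (fun w hw => (h _ (mem_WF.1 hw).1).2.1)
        (fun w hw => (h _ (mem_BF.1 hw).1).2.1) (fun _ _ => rfl)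
    rw [this, ← Finset.prod_mul_distrib]
    refine Finset.prod_congr rfl fun w hw => ?_
    unfold om th
    rw [(h _ (mem_WF.1 hw).1).2.1]
  rw [e1, ← Finset.prod_pow_eq_pow_sum, ← Finset.prod_mul_distrib]
  refine Finset.prod_congr rfl fun w hw => ?_
  have sq : ((-1 : ℤ) ^ idx R w) * (-1) ^ idx R w = 1 := by
    rw [← mul_pow]; simp
  unfold th U
  split_ifs <;> simp [sq]

lemma aux_pow (x y z t : ℕ) (h : y = z) : (-1 : ℤ) ^ (x + (x + y)) = (-1) ^ (t + (t + z)) := by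
  subst h
  rw [← add_assoc, ← add_assoc, pow_add, pow_add (n := y), Even.neg_one_pow ⟨_, rfl⟩,
    Even.neg_one_pow ⟨_, rfl⟩]

lemma sign_const {R : Finset (ℤ × ℤ)} {P Q : ℤ × ℤ → ℤ × ℤ} (h : IsM R P) (h' : IsM R Q) :
    (-1 : ℤ) ^ (∑ i ∈ WF R, ∑ j ∈ WF R, if lt i j ∧ lt (P j) (P i) then 1 else 0) *
      ∏ w ∈ WF R, om R w (P w) =
    (-1 : ℤ) ^ (∑ i ∈ WF R, ∑ j ∈ WF R, if lt i j ∧ lt (Q j) (Q i) then 1 else 0) *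
      ∏ w ∈ WF R, om R w (Q w) := by
  rw [om_prod h, om_prod h', inv_eq h, inv_eq h', ← mul_assoc, ← mul_assoc, ← pow_add, ← pow_add]
  congr 1
  have a := q_sum R P
  have b := q_sum R Q
  have c := kk_sq R P
  have d := kk_sq R Q
  have e : kk R P = kk R Q := funext (kk_eq h h')
  rw [sumU] at c d
  rw [e] at c
  rw [← a, ← b]
  exact aux_pow _ _ _ _ (by omega)

lemma exists_enum {α : Type} [Fintype α] (f : α → ℤ × ℤ) (hf : Function.Injective f) {N : ℕ}
    (hN : Fintype.card α = N) : ∃ e : Fin N ≃ α, ∀ i j, i < j ↔ lt (f (e i)) (f (e j)) := by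
  let key : α → ℤ ×ₗ ℤ := fun a => toLex (cc (f a), ss (f a))
  have hk : Function.Injective key := by
    intro a b h
    have h' : (cc (f a), ss (f a)) = (cc (f b), ss (f b)) := toLex.injective h
    rw [Prod.mk.injEq] at h'
    exact hf (ext_cs h'.1 h'.2)
  let _ : LinearOrder α := LinearOrder.lift' key hk
  let o := Fintype.orderIsoFinOfCardEq α hN
  refine ⟨o.toEquiv, fun i j => ?_⟩
  have h1 : o i < o j ↔ key (o i) < key (o j) := Iff.rfl
  rw [← o.lt_iff_lt, h1, Prod.Lex.lt_iff]
  rfl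

def Kent (R : Finset (ℤ × ℤ)) (w b : ℤ × ℤ) : ℤ := if Adjacent w b then om R w b else 0

lemma sign_inv {N : ℕ} (π : Equiv.Perm (Fin N)) :
    ((Equiv.Perm.sign π : ℤˣ) : ℤ) =
      (-1) ^ (∑ i, ∑ j, if i < j ∧ π j < π i then 1 else 0) := by
  rw [Equiv.Perm.sign_eq_prod_prod_Ioi, ← Finset.prod_pow_eq_pow_sum]
  push_cast
  refine Finset.prod_congr rfl fun i _ => ?_
  rw [← Finset.prod_pow_eq_pow_sum, ← Finset.prod_subset (Finset.subset_univ (Finset.Ioi i))]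
  · refine Finset.prod_congr rfl fun j hj => ?_
    have hj := Finset.mem_Ioi.1 hj
    have : π i ≠ π j := fun h => hj.ne (π.injective h)
    by_cases h : π i < π j
    · simp [h, h.not_gt]
    · have : π j < π i := lt_of_le_of_ne (not_lt.1 h) this.symm
      simp [h, this, hj]
  · intro j _ hj
    rw [Finset.mem_Ioi] at hj
    simp [hj]

lemma good_term {R : Finset (ℤ × ℤ)} {N : ℕ} {eW : Fin N ≃ WF R} {eB : Fin N ≃ BF R}
    (hW : ∀ i j, i < j ↔ lt (eW i).1 (eW j).1) (hB : ∀ i j, i < j ↔ lt (eB i).1 (eB j).1)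
    (π : Equiv.Perm (Fin N)) (hπ : ∀ i, Adjacent (eW i).1 (eB (π i)).1) :
    ∃ P, IsM R P ∧ ((Equiv.Perm.sign π : ℤˣ) : ℤ) * ∏ i, Kent R (eW i).1 (eB (π i)).1 =
      (-1 : ℤ) ^ (∑ i ∈ WF R, ∑ j ∈ WF R, if lt i j ∧ lt (P j) (P i) then 1 else 0) *
      ∏ w ∈ WF R, om R w (P w) := by
  let σ : WF R ≃ BF R := eW.symm.trans (π.trans eB)
  let P : ℤ × ℤ → ℤ × ℤ := fun v => if h : v ∈ WF R then (σ ⟨v, h⟩).1 else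
    if h : v ∈ BF R then (σ.symm ⟨v, h⟩).1 else v
  have hd : ∀ v, v ∈ BF R → v ∉ WF R := fun v h h' => (mem_BF.1 h).2 (mem_WF.1 h').2
  have PW : ∀ w : WF R, P w.1 = (σ w).1 := fun w => by
    simp only [P]; rw [dif_pos w.2]
  have PB : ∀ b : BF R, P b.1 = (σ.symm b).1 := fun b => by
    simp only [P]; rw [dif_neg (hd _ b.2), dif_pos b.2]
  have hσ : ∀ w : WF R, Adjacent w.1 (σ w).1 := fun w => by
    have := hπ (eW.symm w)
    simpa [σ] using this
  have hP : IsM R P := by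
    intro v hv
    by_cases h : (v.1 + v.2) % 2 = 0
    · have hw : v ∈ WF R := mem_WF.2 ⟨hv, h⟩
      have e := PW ⟨v, hw⟩
      simp only at e
      rw [e, PB, Equiv.symm_apply_apply]
      exact ⟨(mem_BF.1 (σ ⟨v, hw⟩).2).1, rfl, hσ ⟨v, hw⟩⟩
    · have hw : v ∈ BF R := mem_BF.2 ⟨hv, h⟩
      have e := PB ⟨v, hw⟩
      simp only at e
      rw [e, PW, Equiv.apply_symm_apply]
      refine ⟨(mem_WF.1 (σ.symm ⟨v, hw⟩).2).1, rfl, adj_symm ?_⟩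
      have := hσ (σ.symm ⟨v, hw⟩)
      rwa [Equiv.apply_symm_apply] at this
  have PE : ∀ i, P (eW i).1 = (eB (π i)).1 := fun i => by rw [PW]; simp [σ]
  refine ⟨P, hP, ?_⟩
  rw [sign_inv]
  congr 1
  · congr 1
    rw [← Finset.sum_coe_sort (WF R), ← Equiv.sum_comp eW]
    refine Finset.sum_congr rfl fun i _ => ?_
    rw [← Finset.sum_coe_sort (WF R), ← Equiv.sum_comp eW]
    refine Finset.sum_congr rfl fun j _ => ?_
    rw [PE, PE]
    simp only [← hW, ← hB]
  · rw [← Finset.prod_coe_sort (WF R), ← Equiv.prod_comp eW]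
    refine Finset.prod_congr rfl fun i _ => ?_
    rw [PE]; unfold Kent; rw [if_pos (hπ i)]

lemma om_abs (R : Finset (ℤ × ℤ)) (w b : ℤ × ℤ) : |om R w b| = 1 := by
  unfold om
  rw [abs_mul]
  split_ifs <;> simp

theorem kasteleyn (R : Finset (ℤ × ℤ)) (e : WF R ≃ BF R) :
    (numTilings (R : Set (ℤ × ℤ)) : ℤ) =
      |Matrix.det (Matrix.of fun (i j : WF R) => Kent R i.1 (e j).1)| := by
  classical
  obtain ⟨eW, hW⟩ := exists_enum (fun w : WF R => w.1) Subtype.val_injective rfl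
  obtain ⟨eB, hB⟩ := exists_enum (fun w : BF R => w.1) Subtype.val_injective
    (Fintype.card_congr e).symm
  generalize Fintype.card (WF R) = N at *
  let M0 : Matrix (Fin N) (Fin N) ℤ := Matrix.of fun i j => Kent R (eW j).1 (eB i).1
  have h1 : |Matrix.det (Matrix.of fun (i j : WF R) => Kent R i.1 (e j).1)| = |M0.det| := by
    rw [← Matrix.det_submatrix_equiv_self eW, ← Matrix.det_transpose M0,
      ← Matrix.abs_det_submatrix_equiv_equiv (Equiv.refl _) (eW.trans (e.trans eB.symm))
        M0.transpose]
    congr 2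
    ext i j
    simp [M0]
  have h2 : numTilings (R : Set (ℤ × ℤ)) =
      (Finset.univ.filter fun π : Equiv.Perm (Fin N) =>
        ∀ i, Adjacent (eW i).1 (eB (π i)).1).card := by
    rw [tilings_card, ← Fintype.card_subtype, ← Nat.card_eq_fintype_card]
    symm
    refine Nat.card_congr (Equiv.subtypeEquiv (Equiv.equivCongr eW eB) ?_)
    intro π
    constructor
    · intro h w
      have := h (eW.symm w)
      simpa using this
    · intro h i
      have := h (eW i)
      simpa using this
  rw [h1, h2, Matrix.det_apply']
  have h3 : ∑ π : Equiv.Perm (Fin N), ((Equiv.Perm.sign π : ℤˣ) : ℤ) * ∏ i, M0 (π i) i =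
      ∑ π ∈ Finset.univ.filter (fun π : Equiv.Perm (Fin N) =>
        ∀ i, Adjacent (eW i).1 (eB (π i)).1),
        ((Equiv.Perm.sign π : ℤˣ) : ℤ) * ∏ i, M0 (π i) i := by
    symm
    apply Finset.sum_filter_of_ne
    intro π _ hne i
    by_contra hi
    apply hne
    rw [Finset.prod_eq_zero (Finset.mem_univ i), mul_zero]
    simp [M0, Kent, hi]
  simp only [Int.cast_id]
  rw [h3]
  rcases Finset.eq_empty_or_nonempty (Finset.univ.filter (fun π : Equiv.Perm (Fin N) =>
        ∀ i, Adjacent (eW i).1 (eB (π i)).1)) with h | ⟨π0, h⟩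
  · rw [h]; simp
  · have h0 := (Finset.mem_filter.1 h).2
    have hc : ∀ π ∈ Finset.univ.filter (fun π : Equiv.Perm (Fin N) =>
        ∀ i, Adjacent (eW i).1 (eB (π i)).1),
        ((Equiv.Perm.sign π : ℤˣ) : ℤ) * ∏ i, M0 (π i) i =
          ((Equiv.Perm.sign π0 : ℤˣ) : ℤ) * ∏ i, M0 (π0 i) i := by
      intro π hπ
      obtain ⟨P, hP, hPe⟩ := good_term hW hB π (Finset.mem_filter.1 hπ).2
      obtain ⟨Q, hQ, hQe⟩ := good_term hW hB π0 h0
      have := sign_const hP hQ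
      rw [← hPe, ← hQe] at this
      simpa [M0] using this
    rw [Finset.sum_congr rfl hc, Finset.sum_const, nsmul_eq_mul, abs_mul, abs_mul,
      Finset.abs_prod, Finset.prod_eq_one]
    · have : |((Equiv.Perm.sign π0 : ℤˣ) : ℤ)| = 1 := by
        rcases Int.units_eq_one_or (Equiv.Perm.sign π0) with h | h <;> rw [h] <;> simp
      rw [this]; simp
    · intro i _
      simp only [M0, Matrix.of_apply, Kent]
      rw [if_pos (h0 i), om_abs]

lemma det_block {r : Type} [Fintype r] [DecidableEq r] (KA ZA ZB KB E : Matrix r r ℤ)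
    (h1 : E * ZA = 0) (h2 : E * KA = KB - ZB) :
    (Matrix.fromBlocks KA ZA (-ZB) KB).det = (KA + ZA).det * KB.det := by
  have e1 : Matrix.fromBlocks KA ZA (-ZB) KB * Matrix.fromBlocks 1 0 1 1 =
      Matrix.fromBlocks 1 0 E 1 * Matrix.fromBlocks (KA + ZA) ZA 0 KB := by
    rw [Matrix.fromBlocks_multiply, Matrix.fromBlocks_multiply]
    congr 1
    · simp
    · simp
    · simp [Matrix.mul_add, h1, h2]; abel
    · simp [h1]
  have e2 := congrArg Matrix.det e1
  rw [Matrix.det_mul, Matrix.det_mul, Matrix.det_fromBlocks_zero₁₂, Matrix.det_fromBlocks_zero₁₂,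
    Matrix.det_fromBlocks_zero₂₁] at e2
  simpa using e2

def BuF (R : Finset (ℤ × ℤ)) : Finset (ℤ × ℤ) :=
  R.filter (fun v => ¬ (v.1 + v.2) % 2 = 0 ∧ 1 ≤ cc v)
def WuF (R : Finset (ℤ × ℤ)) : Finset (ℤ × ℤ) :=
  R.filter (fun v => (v.1 + v.2) % 2 = 0 ∧ 1 ≤ cc v)
def LAF (R : Finset (ℤ × ℤ)) : Finset (ℤ × ℤ) := R.filter (fun v => cc v = 0 ∧ idx R v % 2 = 0)
def LBF (R : Finset (ℤ × ℤ)) : Finset (ℤ × ℤ) := R.filter (fun v => cc v = 0 ∧ ¬ idx R v % 2 = 0)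

def H (R : Finset (ℤ × ℤ)) (b v : ℤ × ℤ) : ℤ :=
  if Adjacent v b then (if cc b ≤ cc v then (-1) ^ idx R v else (-1) ^ idx R b) else 0

def Sym (R : Finset (ℤ × ℤ)) : Prop := ∀ v ∈ R, v.swap ∈ R

lemma idx_swap {R : Finset (ℤ × ℤ)} (hR : Sym R) (v : ℤ × ℤ) : idx R v.swap = idx R v := by
  unfold idx
  refine Finset.card_bij' (fun u _ => u.swap) (fun u _ => u.swap) ?_ ?_ ?_ ?_
  · intro u hu
    simp only [Finset.mem_filter, cc, ss, Prod.fst_swap, Prod.snd_swap] at hu ⊢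
    exact ⟨hR u hu.1, by omega, by omega⟩
  · intro u hu
    simp only [Finset.mem_filter, cc, ss, Prod.fst_swap, Prod.snd_swap] at hu ⊢
    exact ⟨hR u hu.1, by omega, by omega⟩
  · simp
  · simp

lemma cc_swap (v : ℤ × ℤ) : cc v.swap = - cc v := by simp [cc]

lemma K1 (R : Finset (ℤ × ℤ)) {w b : ℤ × ℤ} (hw : 1 ≤ cc w) (hb : 1 ≤ cc b) :
    Kent R w b = H R b w := by
  unfold Kent H
  split_ifs with h h'
  · have := (adj_cc h).1
    unfold om
    rw [if_neg (by omega), if_neg (by omega), if_neg (by omega), if_pos (by omega), mul_one]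
  · have := (adj_cc h).1
    unfold om
    rw [if_neg (by omega), if_pos (by omega), if_neg (by omega), if_neg (by omega), one_mul]
  · rfl

lemma K2 (R : Finset (ℤ × ℤ)) {a b : ℤ × ℤ} (ha : cc a = 0) (hb : 1 ≤ cc b) :
    Kent R a b = (-1) ^ idx R a * H R b a := by
  unfold Kent H
  split_ifs with h h'
  · omega
  · have := (adj_cc h).1
    unfold om
    rw [if_pos (by omega), if_pos (by omega), if_neg (by omega), if_neg (by omega)]
  · simp

lemma K3 (R : Finset (ℤ × ℤ)) {w b : ℤ × ℤ} (hw : 1 ≤ cc w) (hb : 1 ≤ cc b) :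
    Kent R w b.swap = 0 := by
  unfold Kent
  rw [if_neg]
  intro h
  have := (adj_cc h).1
  rw [cc_swap] at this
  omega

lemma K3' (R : Finset (ℤ × ℤ)) {w b : ℤ × ℤ} (hw : 1 ≤ cc w) (hb : 1 ≤ cc b) :
    Kent R w.swap b = 0 := by
  unfold Kent
  rw [if_neg]
  intro h
  have := (adj_cc h).1
  rw [cc_swap] at this
  omega

lemma adj_swap {a b : ℤ × ℤ} : Adjacent a.swap b.swap ↔ Adjacent a b := by
  unfold Adjacent; simp only [Prod.fst_swap, Prod.snd_swap]; tauto

lemma swap_of_cc {a : ℤ × ℤ} (ha : cc a = 0) : a.swap = a := by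
  simp only [cc] at ha
  ext
  · rw [Prod.fst_swap]; omega
  · rw [Prod.snd_swap]; omega

lemma K5 {R : Finset (ℤ × ℤ)} (hR : Sym R) {w b : ℤ × ℤ} (hw : 0 ≤ cc w) (hb : 1 ≤ cc b) :
    Kent R w.swap b.swap = H R b w := by
  unfold Kent H
  simp only [adj_swap]
  split_ifs with h h'
  · have := (adj_cc h).1
    unfold om
    simp only [cc_swap, idx_swap hR]
    rw [if_pos (by omega), if_pos (by omega), if_pos (by omega), if_neg (by omega), mul_one]
  · have := (adj_cc h).1
    unfold om
    simp only [cc_swap, idx_swap hR]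
    rw [if_pos (by omega), if_neg (by omega), if_pos (by omega), if_pos (by omega), one_mul]
  · rfl

lemma K4 {R : Finset (ℤ × ℤ)} (hR : Sym R) {a b : ℤ × ℤ} (ha : cc a = 0) (hb : 1 ≤ cc b) :
    Kent R a b.swap = H R b a := by
  have := K5 hR (w := a) (b := b) (by omega) hb
  rwa [swap_of_cc ha] at this

lemma mem_BuF {R : Finset (ℤ × ℤ)} {v : ℤ × ℤ} :
    v ∈ BuF R ↔ v ∈ R ∧ ¬ (v.1 + v.2) % 2 = 0 ∧ 1 ≤ cc v := by simp [BuF]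
lemma mem_WuF {R : Finset (ℤ × ℤ)} {v : ℤ × ℤ} :
    v ∈ WuF R ↔ v ∈ R ∧ (v.1 + v.2) % 2 = 0 ∧ 1 ≤ cc v := by simp [WuF]
lemma mem_LAF {R : Finset (ℤ × ℤ)} {v : ℤ × ℤ} :
    v ∈ LAF R ↔ v ∈ R ∧ cc v = 0 ∧ idx R v % 2 = 0 := by simp [LAF]
lemma mem_LBF {R : Finset (ℤ × ℤ)} {v : ℤ × ℤ} :
    v ∈ LBF R ↔ v ∈ R ∧ cc v = 0 ∧ ¬ idx R v % 2 = 0 := by simp [LBF]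

lemma exists_eB {R : Finset (ℤ × ℤ)} (hR : Sym R) :
    ∃ e : BuF R ⊕ BuF R ≃ BF R, (∀ b, (e (Sum.inl b)).1 = b.1) ∧
      (∀ b, (e (Sum.inr b)).1 = b.1.swap) := by
  let f : BuF R ⊕ BuF R → BF R := Sum.elim
    (fun b => ⟨b.1, mem_BF.2 ⟨(mem_BuF.1 b.2).1, (mem_BuF.1 b.2).2.1⟩⟩)
    (fun b => ⟨b.1.swap, mem_BF.2 ⟨hR _ (mem_BuF.1 b.2).1, by
      have := (mem_BuF.1 b.2).2.1
      simp only [Prod.fst_swap, Prod.snd_swap]; omega⟩⟩)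
  have hf : Function.Bijective f := by
    constructor
    · rintro (⟨x, hx⟩ | ⟨x, hx⟩) (⟨y, hy⟩ | ⟨y, hy⟩) h <;>
      (have h' := congrArg Subtype.val h
       have h1 := (mem_BuF.1 hx).2.2
       have h2 := (mem_BuF.1 hy).2.2
       simp only [f, Sum.elim_inl, Sum.elim_inr] at h')
      · subst h'; rfl
      · rw [h', cc_swap] at h1; omega
      · rw [← h', cc_swap] at h2; omega
      · have := Prod.swap_injective h'
        subst this; rfl
    · rintro ⟨v, hv⟩
      have h := mem_BF.1 hv
      by_cases hc : 1 ≤ cc v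
      · exact ⟨Sum.inl ⟨v, mem_BuF.2 ⟨h.1, h.2, hc⟩⟩, rfl⟩
      · refine ⟨Sum.inr ⟨v.swap, mem_BuF.2 ⟨hR _ h.1, ?_, ?_⟩⟩, ?_⟩
        · simp only [Prod.fst_swap, Prod.snd_swap]; omega
        · have := h.2
          simp only [cc, Prod.fst_swap, Prod.snd_swap] at *; omega
        · apply Subtype.ext; simp [f]
  exact ⟨Equiv.ofBijective f hf, fun b => rfl, fun b => rfl⟩

lemma exists_eW {R : Finset (ℤ × ℤ)} (hR : Sym R) :
    ∃ e : (WuF R ⊕ LAF R) ⊕ (WuF R ⊕ LBF R) ≃ WF R,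
      (∀ b, (e (Sum.inl (Sum.inl b))).1 = b.1) ∧ (∀ b, (e (Sum.inl (Sum.inr b))).1 = b.1) ∧
      (∀ b, (e (Sum.inr (Sum.inl b))).1 = b.1.swap) ∧ (∀ b, (e (Sum.inr (Sum.inr b))).1 = b.1) := by
  let f : (WuF R ⊕ LAF R) ⊕ (WuF R ⊕ LBF R) → WF R := Sum.elim (Sum.elim
    (fun b => ⟨b.1, mem_WF.2 ⟨(mem_WuF.1 b.2).1, (mem_WuF.1 b.2).2.1⟩⟩)
    (fun b => ⟨b.1, mem_WF.2 ⟨(mem_LAF.1 b.2).1, by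
      have := (mem_LAF.1 b.2).2.1
      simp only [cc] at this; omega⟩⟩)) (Sum.elim
    (fun b => ⟨b.1.swap, mem_WF.2 ⟨hR _ (mem_WuF.1 b.2).1, by
      have := (mem_WuF.1 b.2).2.1
      simp only [Prod.fst_swap, Prod.snd_swap]; omega⟩⟩)
    (fun b => ⟨b.1, mem_WF.2 ⟨(mem_LBF.1 b.2).1, by
      have := (mem_LBF.1 b.2).2.1
      simp only [cc] at this; omega⟩⟩))
  have hf : Function.Bijective f := by
    constructor
    · rintro ((⟨x, hx⟩ | ⟨x, hx⟩) | (⟨x, hx⟩ | ⟨x, hx⟩))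
        ((⟨y, hy⟩ | ⟨y, hy⟩) | (⟨y, hy⟩ | ⟨y, hy⟩)) h <;>
      (have h' := congrArg Subtype.val h
       have hx' := hx
       have hy' := hy
       simp only [f, Sum.elim_inl, Sum.elim_inr] at h'
       simp only [mem_WuF, mem_LAF, mem_LBF] at hx' hy'
       first
       | (subst h'; rfl)
       | (have := Prod.swap_injective h'; subst this; rfl)
       | (exfalso; subst h'; try simp only [cc_swap] at hx' hy'
          omega)
       | (exfalso; rw [h'] at hx'; try simp only [cc_swap] at hx' hy'
          omega)
       | (exfalso; rw [← h'] at hy'; try simp only [cc_swap] at hx' hy'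
          omega))
    · rintro ⟨v, hv⟩
      have h := mem_WF.1 hv
      rcases lt_trichotomy (cc v) 0 with hc | hc | hc
      · refine ⟨Sum.inr (Sum.inl ⟨v.swap, mem_WuF.2 ⟨hR _ h.1, ?_, ?_⟩⟩), ?_⟩
        · simp only [Prod.fst_swap, Prod.snd_swap]; omega
        · rw [cc_swap]; omega
        · apply Subtype.ext; simp [f]
      · by_cases hi : idx R v % 2 = 0
        · exact ⟨Sum.inl (Sum.inr ⟨v, mem_LAF.2 ⟨h.1, hc, hi⟩⟩), rfl⟩
        · exact ⟨Sum.inr (Sum.inr ⟨v, mem_LBF.2 ⟨h.1, hc, hi⟩⟩), rfl⟩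
      · exact ⟨Sum.inl (Sum.inl ⟨v, mem_WuF.2 ⟨h.1, h.2, by omega⟩⟩), rfl⟩
  exact ⟨Equiv.ofBijective f hf, fun b => rfl, fun b => rfl, fun b => rfl, fun b => rfl⟩

set_option linter.unusedSimpArgs false

/-- half matrix -/
def HM (R : Finset (ℤ × ℤ)) {S T : Finset (ℤ × ℤ)} (f : S ⊕ T ≃ BuF R) :
    Matrix (BuF R) (BuF R) ℤ :=
  Matrix.of fun i j => H R j.1 (Sum.elim (fun a => a.1) (fun a => a.1) (f.symm i))

def ZM (R : Finset (ℤ × ℤ)) {S T : Finset (ℤ × ℤ)} (f : S ⊕ T ≃ BuF R) :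
    Matrix (BuF R) (BuF R) ℤ :=
  Matrix.of fun i j => Sum.elim (fun _ => 0) (fun a : T => H R j.1 a.1) (f.symm i)

lemma HM_add_ZM (R : Finset (ℤ × ℤ)) {S T : Finset (ℤ × ℤ)} (f : S ⊕ T ≃ BuF R) :
    (HM R f + ZM R f).det = 2 ^ T.card * (HM R f).det := by
  have : HM R f + ZM R f =
      Matrix.diagonal (fun i => Sum.elim (fun _ => (1 : ℤ)) (fun _ => 2) (f.symm i)) * HM R f := by
    ext i j
    rw [Matrix.diagonal_mul]
    simp only [Matrix.add_apply, HM, ZM, Matrix.of_apply]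
    rcases f.symm i with a | a
    · simp
    · simp; ring
  rw [this, Matrix.det_mul, Matrix.det_diagonal]
  congr 1
  rw [← Equiv.prod_comp f]
  simp

theorem factor {R : Finset (ℤ × ℤ)} (hR : Sym R) (fA : WuF R ⊕ LAF R ≃ BuF R)
    (fB : WuF R ⊕ LBF R ≃ BuF R) :
    (numTilings (R : Set (ℤ × ℤ)) : ℤ) =
      2 ^ (LAF R).card * |(HM R fA).det| * |(HM R fB).det| := by
  obtain ⟨eB, eB1, eB2⟩ := exists_eB hR
  obtain ⟨eW, eW1, eW2, eW3, eW4⟩ := exists_eW hR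
  rw [kasteleyn R (eW.symm.trans ((fA.sumCongr fB).trans eB)),
    ← Matrix.det_submatrix_equiv_self ((fA.sumCongr fB).symm.trans eW)]
  let E : Matrix (BuF R) (BuF R) ℤ := Matrix.of fun i k =>
    Sum.elim (fun w => if fA (Sum.inl w) = k then 1 else 0) (fun _ => 0) (fB.symm i)
  have hb : ∀ b : BuF R, 1 ≤ cc b.1 := fun b => (mem_BuF.1 b.2).2.2
  have hw : ∀ b : WuF R, 1 ≤ cc b.1 := fun b => (mem_WuF.1 b.2).2.2
  have ha : ∀ b : LAF R, cc b.1 = 0 := fun b => (mem_LAF.1 b.2).2.1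
  have hl : ∀ b : LBF R, cc b.1 = 0 := fun b => (mem_LBF.1 b.2).2.1
  have key := det_block (HM R fA) (ZM R fA) (ZM R fB) (HM R fB) E ?_ ?_
  · rw [HM_add_ZM] at key
    have e : Matrix.submatrix (Matrix.of fun (i j : WF R) =>
        Kent R i.1 ((eW.symm.trans ((fA.sumCongr fB).trans eB)) j).1)
        ((fA.sumCongr fB).symm.trans eW) ((fA.sumCongr fB).symm.trans eW) =
        Matrix.fromBlocks (HM R fA) (ZM R fA) (-ZM R fB) (HM R fB) := by
      ext i j
      rcases i with i | i <;> rcases j with j | j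
      · simp only [Matrix.submatrix_apply, Matrix.of_apply, Matrix.fromBlocks_apply₁₁, HM,
          Equiv.trans_apply, Equiv.symm_apply_apply, Equiv.apply_symm_apply,
          Equiv.sumCongr_symm, Equiv.sumCongr_apply, Sum.map_inl, Sum.map_inr, eB1, eB2]
        rcases fA.symm i with a | a
        · simp only [eW1, Sum.elim_inl]; exact K1 R (hw a) (hb j)
        · simp only [eW2, Sum.elim_inr]; rw [K2 R (ha a) (hb j)]
          rw [Even.neg_one_pow (Nat.even_iff.2 (mem_LAF.1 a.2).2.2), one_mul]
      · simp only [Matrix.submatrix_apply, Matrix.of_apply, Matrix.fromBlocks_apply₁₂, ZM,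
          Equiv.trans_apply, Equiv.symm_apply_apply, Equiv.apply_symm_apply,
          Equiv.sumCongr_symm, Equiv.sumCongr_apply, Sum.map_inl, Sum.map_inr, eB1, eB2]
        rcases fA.symm i with a | a
        · simp only [eW1, Sum.elim_inl]; exact K3 R (hw a) (hb j)
        · simp only [eW2, Sum.elim_inr]; exact K4 hR (ha a) (hb j)
      · simp only [Matrix.submatrix_apply, Matrix.of_apply, Matrix.fromBlocks_apply₂₁, ZM,
          Equiv.trans_apply, Equiv.symm_apply_apply, Equiv.apply_symm_apply, Matrix.neg_apply,
          Equiv.sumCongr_symm, Equiv.sumCongr_apply, Sum.map_inl, Sum.map_inr, eB1, eB2]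
        rcases fB.symm i with a | a
        · simp only [eW3, Sum.elim_inl]; rw [K3' R (hw a) (hb j), neg_zero]
        · simp only [eW4, Sum.elim_inr]; rw [K2 R (hl a) (hb j)]
          rw [Odd.neg_one_pow (Nat.odd_iff.2 (by have := (mem_LBF.1 a.2).2.2; omega))]; ring
      · simp only [Matrix.submatrix_apply, Matrix.of_apply, Matrix.fromBlocks_apply₂₂, HM,
          Equiv.trans_apply, Equiv.symm_apply_apply, Equiv.apply_symm_apply,
          Equiv.sumCongr_symm, Equiv.sumCongr_apply, Sum.map_inl, Sum.map_inr, eB1, eB2]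
        rcases fB.symm i with a | a
        · simp only [eW3, Sum.elim_inl]; exact K5 hR (by have := hw a; omega) (hb j)
        · simp only [eW4, Sum.elim_inr]; exact K4 hR (hl a) (hb j)
    rw [e, key, abs_mul, abs_mul]
    simp
  · ext i j
    rw [Matrix.mul_apply]
    simp only [E, ZM, Matrix.of_apply, Matrix.zero_apply]
    rcases fB.symm i with a | a
    · simp
    · simp
  · ext i j
    rw [Matrix.mul_apply]
    simp only [E, ZM, HM, Matrix.of_apply, Matrix.sub_apply]
    rcases fB.symm i with a | a
    · simp
    · simp

noncomputable def RR (m n : ℕ) : Finset (ℤ × ℤ) :=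
  (Finset.Icc (0 : ℤ) (2 * n) ×ˢ Finset.Icc (0 : ℤ) (2 * n)).filter
    (fun q => ¬((n : ℤ) - m ≤ q.1 ∧ q.1 ≤ (n : ℤ) + m ∧ (n : ℤ) - m ≤ q.2 ∧ q.2 ≤ (n : ℤ) + m))

lemma mem_RR {m n : ℕ} {q : ℤ × ℤ} : q ∈ RR m n ↔
    0 ≤ q.1 ∧ q.1 ≤ 2 * n ∧ 0 ≤ q.2 ∧ q.2 ≤ 2 * n ∧
    ¬((n : ℤ) - m ≤ q.1 ∧ q.1 ≤ (n : ℤ) + m ∧ (n : ℤ) - m ≤ q.2 ∧ q.2 ≤ (n : ℤ) + m) := by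
  simp only [RR, Finset.mem_filter, Finset.mem_product, Finset.mem_Icc]
  tauto

lemma RR_coe (m n : ℕ) : (RR m n : Set (ℤ × ℤ)) = oddHoleySquare m n := by
  ext q
  simp only [Finset.mem_coe, mem_RR, oddHoleySquare, Set.mem_ofPred_eq]
  omega

lemma RR_sym (m n : ℕ) : Sym (RR m n) := by
  intro v hv
  rw [mem_RR] at *
  simp only [Prod.fst_swap, Prod.snd_swap]
  omega

def rot (n : ℕ) (p : ℤ × ℤ) : ℤ × ℤ :=
  if n - p.1 ≤ p.2 - n ∧ p.2 < p.1 then (p.1, p.2 + 1)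
  else if n - p.2 < p.1 - n ∧ p.1 ≤ p.2 then (p.1 - 1, p.2)
  else if p.1 < p.2 ∧ p.2 - n ≤ n - p.1 then (p.1, p.2 - 1)
  else (p.1 + 1, p.2)

lemma rot_mem {m n : ℕ} {p : ℤ × ℤ} (h : p ∈ RR m n) : rot n p ∈ RR m n := by
  rw [mem_RR] at *
  unfold rot
  split_ifs <;> dsimp only <;> omega

lemma rot_par (n : ℕ) (p : ℤ × ℤ) :
    ((rot n p).1 + (rot n p).2) % 2 = 0 ↔ ¬ (p.1 + p.2) % 2 = 0 := by
  unfold rot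
  split_ifs <;> dsimp only <;> omega

lemma rot_inj {m n : ℕ} {p q : ℤ × ℤ} (hp : p ∈ RR m n) (hq : q ∈ RR m n)
    (h : rot n p = rot n q) : p = q := by
  rw [mem_RR] at *
  obtain ⟨a, b⟩ := p
  obtain ⟨c, d⟩ := q
  unfold rot at h
  split_ifs at h <;> simp only [Prod.mk.injEq] at h ⊢ <;> dsimp only at * <;> omega

lemma card_WB (m n : ℕ) : (WF (RR m n)).card = (BF (RR m n)).card := by
  apply le_antisymm
  · refine Finset.card_le_card_of_injOn (rot n) ?_ ?_
    · intro p hp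
      have hp := mem_WF.1 hp
      refine mem_BF.2 ⟨rot_mem hp.1, ?_⟩
      rw [rot_par]; simpa using hp.2
    · intro p hp q hq h
      exact rot_inj (mem_WF.1 hp).1 (mem_WF.1 hq).1 h
  · refine Finset.card_le_card_of_injOn (rot n) ?_ ?_
    · intro p hp
      have hp := mem_BF.1 hp
      refine mem_WF.2 ⟨rot_mem hp.1, ?_⟩
      rw [rot_par]; exact hp.2
    · intro p hp q hq h
      exact rot_inj (mem_BF.1 hp).1 (mem_BF.1 hq).1 h

/-- antidiagonal reflection -/
def tau (n : ℕ) (v : ℤ × ℤ) : ℤ × ℤ := (2 * n - v.2, 2 * n - v.1)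

lemma tau_tau (n : ℕ) (v : ℤ × ℤ) : tau n (tau n v) = v := by
  simp [tau]

lemma tau_cc (n : ℕ) (v : ℤ × ℤ) : cc (tau n v) = cc v := by
  simp only [tau, cc]; omega

lemma tau_par (n : ℕ) (v : ℤ × ℤ) :
    ((tau n v).1 + (tau n v).2) % 2 = 0 ↔ (v.1 + v.2) % 2 = 0 := by
  simp only [tau]; omega

lemma tau_mem {m n : ℕ} {v : ℤ × ℤ} (h : v ∈ RR m n) : tau n v ∈ RR m n := by
  rw [mem_RR] at *
  simp only [tau]; omega

lemma tau_adj {n : ℕ} {a b : ℤ × ℤ} : Adjacent (tau n a) (tau n b) ↔ Adjacent a b := by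
  simp only [tau, Adjacent]; omega

noncomputable def NN (m n : ℕ) (c : ℤ) : ℕ := ((RR m n).filter (fun u => cc u = c)).card

lemma tau_idx {m n : ℕ} {v : ℤ × ℤ} (h : v ∈ RR m n) :
    idx (RR m n) (tau n v) + idx (RR m n) v + 1 = NN m n (cc v) := by
  have h1 : idx (RR m n) (tau n v) =
      ((RR m n).filter (fun u => cc u = cc v ∧ ss u < ss v)).card := by
    unfold idx
    refine Finset.card_bij' (fun u _ => tau n u) (fun u _ => tau n u) ?_ ?_ ?_ ?_
    · intro u hu
      rw [Finset.mem_filter] at hu ⊢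
      refine ⟨tau_mem hu.1, ?_⟩
      have := hu.2
      simp only [cc, ss, tau] at this ⊢
      omega
    · intro u hu
      rw [Finset.mem_filter] at hu ⊢
      refine ⟨tau_mem hu.1, ?_⟩
      have := hu.2
      simp only [cc, ss, tau] at this ⊢
      omega
    · intro u _; exact tau_tau n u
    · intro u _; exact tau_tau n u
  rw [h1]
  unfold idx NN
  rw [← Finset.card_union_of_disjoint, ← Finset.card_singleton v, ← Finset.card_union_of_disjoint]
  · congr 1
    ext u
    simp only [Finset.mem_union, Finset.mem_filter, Finset.mem_singleton]
    constructor
    · rintro ((hu | hu) | hu)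
      · exact ⟨hu.1, hu.2.1⟩
      · exact ⟨hu.1, hu.2.1⟩
      · subst hu; exact ⟨h, rfl⟩
    · rintro ⟨hu, hc⟩
      rcases lt_trichotomy (ss u) (ss v) with hs | hs | hs
      · exact Or.inl (Or.inl ⟨hu, hc, hs⟩)
      · exact Or.inr (ext_cs hc hs)
      · exact Or.inl (Or.inr ⟨hu, hc, hs⟩)
  · rw [Finset.disjoint_singleton_right]
    simp
  · rw [Finset.disjoint_left]
    intro u hu hu'
    rw [Finset.mem_filter] at hu hu'
    omega

lemma NN_zero {m n : ℕ} (h : m < n) : NN m n 0 = 2 * (n - m) := by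
  have : (RR m n).filter (fun u => cc u = 0) =
      (Finset.Ico (0 : ℤ) (n - m) ∪ Finset.Ioc (n + m : ℤ) (2 * n)).image (fun i => (i, i)) := by
    ext ⟨a, b⟩
    simp only [Finset.mem_filter, mem_RR, Finset.mem_image, Finset.mem_union, Finset.mem_Ico,
      Finset.mem_Ioc, Prod.mk.injEq, cc]
    constructor
    · intro h
      exact ⟨a, by omega, rfl, by omega⟩
    · rintro ⟨c, h, rfl, rfl⟩
      omega
  rw [NN, this, Finset.card_image_of_injective, Finset.card_union_of_disjoint, Int.card_Ico,
    Int.card_Ioc]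
  · omega
  · rw [Finset.disjoint_left]
    intro a ha hb
    rw [Finset.mem_Ico] at ha
    rw [Finset.mem_Ioc] at hb
    omega
  · intro a b hab
    exact (Prod.mk.inj hab).1

lemma tau_LA {m n : ℕ} (h : m < n) {v : ℤ × ℤ} (hv : v ∈ LAF (RR m n)) :
    tau n v ∈ LBF (RR m n) := by
  rw [mem_LAF] at hv
  have h1 := tau_idx hv.1
  rw [hv.2.1, NN_zero h] at h1
  exact mem_LBF.2 ⟨tau_mem hv.1, by rw [tau_cc]; exact hv.2.1, by omega⟩

lemma tau_LB {m n : ℕ} (h : m < n) {v : ℤ × ℤ} (hv : v ∈ LBF (RR m n)) :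
    tau n v ∈ LAF (RR m n) := by
  rw [mem_LBF] at hv
  have h1 := tau_idx hv.1
  rw [hv.2.1, NN_zero h] at h1
  exact mem_LAF.2 ⟨tau_mem hv.1, by rw [tau_cc]; exact hv.2.1, by omega⟩

lemma tau_Wu {m n : ℕ} {v : ℤ × ℤ} (hv : v ∈ WuF (RR m n)) : tau n v ∈ WuF (RR m n) := by
  rw [mem_WuF] at *
  exact ⟨tau_mem hv.1, by rw [tau_par]; exact hv.2.1, by rw [tau_cc]; exact hv.2.2⟩

lemma tau_Bu {m n : ℕ} {v : ℤ × ℤ} (hv : v ∈ BuF (RR m n)) : tau n v ∈ BuF (RR m n) := by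
  rw [mem_BuF] at *
  exact ⟨tau_mem hv.1, by rw [tau_par]; exact hv.2.1, by rw [tau_cc]; exact hv.2.2⟩

def tE {n : ℕ} {S T : Finset (ℤ × ℤ)} (h : ∀ v ∈ S, tau n v ∈ T) (h' : ∀ v ∈ T, tau n v ∈ S) :
    S ≃ T where
  toFun v := ⟨tau n v.1, h _ v.2⟩
  invFun v := ⟨tau n v.1, h' _ v.2⟩
  left_inv v := Subtype.ext (tau_tau n v.1)
  right_inv v := Subtype.ext (tau_tau n v.1)

lemma card_LAB {m n : ℕ} (h : m < n) : (LAF (RR m n)).card = (LBF (RR m n)).card := by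
  have := Fintype.card_congr (tE (n := n) (S := LAF (RR m n)) (T := LBF (RR m n))
    (fun v => tau_LA h) (fun v => tau_LB h))
  simpa using this

lemma card_LA {m n : ℕ} (h : m < n) : (LAF (RR m n)).card = n - m := by
  have h1 := card_LAB h
  have h2 : (LAF (RR m n)).card + (LBF (RR m n)).card = NN m n 0 := by
    unfold LAF LBF NN
    rw [← Finset.filter_filter, ← Finset.filter_filter]
    exact Finset.card_filter_add_card_filter_not _
  rw [NN_zero h] at h2
  omega

lemma card_Bu {m n : ℕ} (h : m < n) :
    (WuF (RR m n)).card + (LAF (RR m n)).card = (BuF (RR m n)).card := by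
  obtain ⟨e1, -⟩ := exists_eB (RR_sym m n)
  obtain ⟨e2, -⟩ := exists_eW (RR_sym m n)
  have h1 := Fintype.card_congr e1
  have h2 := Fintype.card_congr e2
  simp only [Fintype.card_sum, Fintype.card_coe] at h1 h2
  have h3 := card_WB m n
  have h4 := card_LAB h
  omega

noncomputable def gg (m n : ℕ) (c : ℤ) : ℤ :=
  ∏ j ∈ Finset.range c.toNat, (-1) ^ (NN m n ((j : ℤ) + 1) + 1)

lemma gg_abs (m n : ℕ) (c : ℤ) : |gg m n c| = 1 := by
  unfold gg
  rw [Finset.abs_prod]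
  exact Finset.prod_eq_one fun j _ => by rw [abs_pow]; simp

lemma gg_sq (m n : ℕ) (c : ℤ) : gg m n c * gg m n c = 1 := by
  rw [← abs_mul_abs_self, gg_abs]; rfl

lemma gg_succ (m n : ℕ) {c : ℤ} (hc : 0 ≤ c) :
    gg m n (c + 1) = gg m n c * (-1) ^ (NN m n (c + 1) + 1) := by
  lift c to ℕ using hc
  unfold gg
  have : ((c : ℤ) + 1).toNat = c + 1 := by omega
  rw [this, Finset.prod_range_succ, Int.toNat_natCast]

lemma idx_tau_pow {m n : ℕ} {v : ℤ × ℤ} (h : v ∈ RR m n) :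
    (-1 : ℤ) ^ idx (RR m n) (tau n v) = (-1) ^ (NN m n (cc v) + 1) * (-1) ^ idx (RR m n) v := by
  rw [← tau_idx h, ← pow_add]
  have : idx (RR m n) (tau n v) + idx (RR m n) v + 1 + 1 + idx (RR m n) v =
    idx (RR m n) (tau n v) + 2 * (idx (RR m n) v + 1) := by ring
  rw [this, pow_add, pow_mul]
  simp

lemma H_tau {m n : ℕ} {b v : ℤ × ℤ} (hb : b ∈ RR m n) (hv : v ∈ RR m n) (hb1 : 1 ≤ cc b)
    (hv0 : 0 ≤ cc v) :
    H (RR m n) (tau n b) (tau n v) = gg m n (cc v) * H (RR m n) b v * gg m n (cc b) := by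
  unfold H
  simp only [tau_adj, tau_cc]
  split_ifs with h1 h2
  · have h3 := (adj_cc h1).1
    have h4 : cc v = cc b + 1 := by omega
    rw [idx_tau_pow hv, h4, gg_succ m n (by omega)]
    linear_combination (-(-1) ^ (NN m n (cc b + 1) + 1) * (-1) ^ idx (RR m n) v) *
      gg_sq m n (cc b)
  · have h3 := (adj_cc h1).1
    have h4 : cc b = cc v + 1 := by omega
    rw [idx_tau_pow hb, h4, gg_succ m n (by omega)]
    linear_combination (-(-1) ^ (NN m n (cc v + 1) + 1) * (-1) ^ idx (RR m n) b) *
      gg_sq m n (cc v)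
  · simp

lemma val_mem {R : Finset (ℤ × ℤ)} (s : WuF R ⊕ LAF R) :
    Sum.elim (fun a => a.1) (fun a => a.1) s ∈ R ∧
    0 ≤ cc (Sum.elim (fun a => a.1) (fun a => a.1) s) := by
  rcases s with s | s
  · have := mem_WuF.1 s.2
    exact ⟨this.1, by simp only [Sum.elim_inl]; omega⟩
  · have := mem_LAF.1 s.2
    exact ⟨this.1, by simp only [Sum.elim_inr]; omega⟩

lemma exists_fB {m n : ℕ} (h : m < n) (fA : WuF (RR m n) ⊕ LAF (RR m n) ≃ BuF (RR m n)) :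
    ∃ fB : WuF (RR m n) ⊕ LBF (RR m n) ≃ BuF (RR m n),
      |(HM (RR m n) fB).det| = |(HM (RR m n) fA).det| := by
  let tW : WuF (RR m n) ⊕ LAF (RR m n) ≃ WuF (RR m n) ⊕ LBF (RR m n) :=
    Equiv.sumCongr (tE (n := n) (fun v => tau_Wu) (fun v => tau_Wu))
      (tE (n := n) (fun v => tau_LA h) (fun v => tau_LB h))
  let tB : BuF (RR m n) ≃ BuF (RR m n) := tE (n := n) (fun v => tau_Bu) (fun v => tau_Bu)
  refine ⟨tW.symm.trans fA, ?_⟩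
  have key : (HM (RR m n) (tW.symm.trans fA)).submatrix (Equiv.refl _) tB =
      Matrix.diagonal (fun i => gg m n (cc (Sum.elim (fun a => a.1) (fun a => a.1) (fA.symm i)))) *
      HM (RR m n) fA * Matrix.diagonal (fun j => gg m n (cc j.1)) := by
    ext i j
    rw [Matrix.mul_diagonal, Matrix.diagonal_mul]
    simp only [HM, Matrix.submatrix_apply, Matrix.of_apply]
    have hj := mem_BuF.1 j.2
    obtain ⟨hv1, hv2⟩ := val_mem (fA.symm i)
    rw [← H_tau hj.1 hv1 hj.2.2 hv2]
    congr 1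
    simp only [Equiv.symm_trans_apply, Equiv.symm_symm, Equiv.refl_apply]
    generalize fA.symm i = s
    rcases s with s | s <;> rfl
  have h2 := congrArg (fun M => |Matrix.det M|) key
  rw [Matrix.abs_det_submatrix_equiv_equiv, Matrix.det_mul, Matrix.det_mul, abs_mul, abs_mul,
    Matrix.det_diagonal, Matrix.det_diagonal, Finset.abs_prod, Finset.abs_prod] at h2
  simpa [gg_abs] using h2

lemma descend {n m p : ℤ} (f : ℤ → ZMod 2) (hp : 0 ≤ p) (hz : ∀ q, 0 ≤ q → p + q ≤ m → f q = 0)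
    (hz' : ∀ q, 0 ≤ q → n < p + q → f q = 0)
    (hs : ∀ q, 0 ≤ q → m < p + q → p + q ≤ n → f q + f (q + 1) = 0) :
    ∀ q, 0 ≤ q → f q = 0 := by
  have : ∀ k : ℕ, ∀ q, 0 ≤ q → n - (p + q) < k → f q = 0 := by
    intro k
    induction k with
    | zero => intro q hq hk; exact hz' q hq (by omega)
    | succ k ih =>
      intro q hq hk
      by_cases h1 : p + q ≤ m
      · exact hz q hq h1
      by_cases h2 : n < p + q
      · exact hz' q hq h2
      have h3 := hs q hq (by omega) (by omega)
      have h4 := ih (q + 1) (by omega) (by omega)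
      linear_combination h3 - h4
  intro q hq
  exact this (n - (p + q) + 1).toNat q hq (by omega)

lemma kernel_zero {m n : ℤ} (F : ℤ → ℤ → ZMod 2)
    (E1 : ∀ p q, 0 ≤ p → 0 ≤ q → m ≤ p + q → p + q ≤ n - 1 →
      F p q + F (p + 1) q + F p (q + 1) + F (p + 1) (q + 1) = 0)
    (E2 : ∀ p q, 0 ≤ p → 0 ≤ q → m ≤ p + q → p + q ≤ n - 1 →
      F (-p) q + F (-(p + 1)) q + F (-p) (q + 1) + F (-(p + 1)) (q + 1) = 0)
    (Z : ∀ p q, 0 ≤ q → (|p| + q ≤ m ∨ n < |p| + q) → F p q = 0)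
    (D : ∀ p, F p 0 = 0 ∨ F (-p) 0 = 0) : ∀ p q, 0 ≤ q → F p q = 0 := by
  have A : ∀ p : ℕ, ∀ q, 0 ≤ q → F p q + F (-p) q = 0 := by
    intro p
    induction p with
    | zero => intro q _; simpa using CharTwo.add_self_eq_zero (F 0 q)
    | succ p ih =>
      refine descend (n := n) (m := m) (p := (p + 1 : ℤ)) _ (by omega) ?_ ?_ ?_
      · intro q hq hm
        push_cast
        rw [Z (p + 1) q hq (by rw [abs_of_nonneg (by omega)]; omega),
          Z (-(p + 1)) q hq (by rw [abs_neg, abs_of_nonneg (by omega)]; omega), add_zero]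
      · intro q hq hm
        push_cast
        rw [Z (p + 1) q hq (by rw [abs_of_nonneg (by omega)]; omega),
          Z (-(p + 1)) q hq (by rw [abs_neg, abs_of_nonneg (by omega)]; omega), add_zero]
      · intro q hq h1 h2
        push_cast
        have e1 := E1 p q (by omega) hq (by omega) (by omega)
        have e2 := E2 p q (by omega) hq (by omega) (by omega)
        have e3 := ih q hq
        have e4 := ih (q + 1) (by omega)
        linear_combination e1 + e2 - e3 - e4
  have B : ∀ q : ℕ, ∀ p, 0 ≤ p → F p q = 0 := by
    intro q
    induction q with
    | zero =>
      intro p hp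
      have a := A p.toNat 0 le_rfl
      rw [Int.toNat_of_nonneg hp] at a
      rcases D p with h | h
      · simpa using h
      · rw [h, add_zero] at a; simpa using a
    | succ q ih =>
      refine descend (n := n) (m := m) (p := (q + 1 : ℤ)) _ (by omega) ?_ ?_ ?_
      · intro p hp hm
        push_cast
        exact Z p (q + 1) (by omega) (by rw [abs_of_nonneg (by omega)]; omega)
      · intro p hp hm
        push_cast
        exact Z p (q + 1) (by omega) (by rw [abs_of_nonneg (by omega)]; omega)
      · intro p hp h1 h2
        push_cast
        have e1 := E1 p q (by omega) (by omega) (by omega) (by omega)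
        have e3 := ih p hp
        have e4 := ih (p + 1) (by omega)
        linear_combination e1 - e3 - e4
  intro p q hq
  have b := B q.toNat |p| (abs_nonneg p)
  have a := A p.natAbs q hq
  rw [Int.toNat_of_nonneg hq] at b
  rw [Int.natCast_natAbs, b, zero_add] at a
  rcases abs_choice p with h | h <;> rw [h] at a b
  · exact b
  · rwa [neg_neg] at a

lemma G_zero {m n : ℕ} (h : m < n) (G : ℤ × ℤ → ZMod 2)
    (h0 : ∀ v, v ∉ WuF (RR m n) → v ∉ LAF (RR m n) → G v = 0)
    (h1 : ∀ b ∈ BuF (RR m n),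
      G (b.1 + 1, b.2) + G (b.1 - 1, b.2) + G (b.1, b.2 + 1) + G (b.1, b.2 - 1) = 0) :
    ∀ v, G v = 0 := by
  have hR : ∀ v, v ∉ RR m n → G v = 0 := fun v hv =>
    h0 v (fun h => hv (mem_WuF.1 h).1) (fun h => hv (mem_LAF.1 h).1)
  have K := kernel_zero (m := m) (n := n) (fun p q => G (n + p + q, n + p - q)) ?_ ?_ ?_ ?_
  · intro v
    by_cases hv : (v.1 + v.2) % 2 = 0 ∧ 0 ≤ cc v
    · have := K ((v.1 + v.2) / 2 - n) ((v.1 - v.2) / 2) (by simp only [cc] at hv; omega)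
      have e : v = ((n : ℤ) + ((v.1 + v.2) / 2 - n) + (v.1 - v.2) / 2,
        (n : ℤ) + ((v.1 + v.2) / 2 - n) - (v.1 - v.2) / 2) := by
        ext <;> dsimp only <;> omega
      rw [e]; exact this
    · refine h0 v (fun h => hv ?_) (fun h => hv ?_)
      · have := mem_WuF.1 h
        exact ⟨this.2.1, by omega⟩
      · have := mem_LAF.1 h
        simp only [cc] at this ⊢
        omega
  · intro p q hp hq hm hn
    have := h1 (n + p + q + 1, n + p - q) (mem_BuF.2 ⟨mem_RR.2 (by dsimp only; omega),
      by dsimp only; omega, by simp only [cc]; omega⟩)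
    dsimp only at this ⊢
    rw [← this]
    ring_nf
  · intro p q hp hq hm hn
    have := h1 (n - p + q, n - p - 1 - q) (mem_BuF.2 ⟨mem_RR.2 (by dsimp only; omega),
      by dsimp only; omega, by simp only [cc]; omega⟩)
    dsimp only at this ⊢
    rw [← this]
    ring_nf
  · intro p q hq hpq
    refine hR _ fun hh => ?_
    rw [mem_RR] at hh
    dsimp only at hh
    rcases abs_cases p with hp | hp <;> omega
  · intro p
    by_cases hA : ((n : ℤ) + p + 0, (n : ℤ) + p - 0) ∈ LAF (RR m n)
    · right
      have hB := mem_LBF.1 (tau_LA h hA)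
      have e : tau n ((n : ℤ) + p + 0, (n : ℤ) + p - 0) = ((n : ℤ) + -p + 0, (n : ℤ) + -p - 0) := by
        simp only [tau, Prod.mk.injEq]; omega
      rw [e] at hB
      refine h0 _ (fun h => ?_) (fun h => hB.2.2 (mem_LAF.1 h).2.2)
      have := (mem_WuF.1 h).2.2
      simp only [cc] at this
      omega
    · left
      refine h0 _ (fun h => ?_) hA
      have := (mem_WuF.1 h).2.2
      simp only [cc] at this
      omega

lemma val_inj {R : Finset (ℤ × ℤ)} {s t : WuF R ⊕ LAF R}
    (h : Sum.elim (fun a => a.1) (fun a => a.1) s = Sum.elim (fun a => a.1) (fun a => a.1) t) :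
    s = t := by
  rcases s with s | s <;> rcases t with t | t <;> simp only [Sum.elim_inl, Sum.elim_inr] at h
  · rw [Subtype.ext h]
  · have h1 := (mem_WuF.1 s.2).2.2
    have h2 := (mem_LAF.1 t.2).2.1
    rw [h] at h1; omega
  · have h1 := (mem_WuF.1 t.2).2.2
    have h2 := (mem_LAF.1 s.2).2.1
    rw [h] at h2; omega
  · rw [Subtype.ext h]

lemma adj_sum (x : ZMod 2) (v b : ℤ × ℤ) : (if Adjacent v b then x else 0) =
    (if v = (b.1 + 1, b.2) then x else 0) + (if v = (b.1 - 1, b.2) then x else 0) +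
    (if v = (b.1, b.2 + 1) then x else 0) + (if v = (b.1, b.2 - 1) then x else 0) := by
  obtain ⟨a, c⟩ := v
  obtain ⟨d, e⟩ := b
  by_cases h : Adjacent (a, c) (d, e)
  · rw [if_pos h]
    simp only [Adjacent, Prod.mk.injEq] at h ⊢
    split_ifs <;> first | omega | simp
  · rw [if_neg h]
    simp only [Adjacent, Prod.mk.injEq] at h ⊢
    split_ifs <;> first | omega | simp

lemma det_odd {m n : ℕ} (h : m < n) (fA : WuF (RR m n) ⊕ LAF (RR m n) ≃ BuF (RR m n)) :
    Odd (HM (RR m n) fA).det := by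
  rw [← Int.not_even_iff_odd]
  intro hev
  have hd : ((HM (RR m n) fA).map (Int.castRingHom (ZMod 2))).det = 0 := by
    have := RingHom.map_det (Int.castRingHom (ZMod 2)) (HM (RR m n) fA)
    rw [RingHom.mapMatrix_apply] at this
    rw [← this]
    simpa using (ZMod.intCast_zmod_eq_zero_iff_dvd _ 2).2 (by exact_mod_cast hev.two_dvd)
  obtain ⟨g, hg0, hg⟩ := Matrix.exists_vecMul_eq_zero_iff.2 hd
  apply hg0
  set val : BuF (RR m n) → ℤ × ℤ :=
    fun i => Sum.elim (fun a => a.1) (fun a => a.1) (fA.symm i) with hval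
  have hinj : ∀ i j, val i = val j → i = j := fun i j hij => fA.symm.injective (val_inj hij)
  have hG := G_zero h (fun v => ∑ i, if val i = v then g i else 0) ?_ ?_
  · ext i
    have := hG (val i)
    try dsimp only at this
    rw [Finset.sum_eq_single i] at this
    · simpa using this
    · intro j _ hj
      rw [if_neg fun e => hj (hinj _ _ e)]
    · simp
  · intro v h1 h2
    refine Finset.sum_eq_zero fun i _ => if_neg ?_
    rintro rfl
    simp only [hval] at h1 h2
    revert h1 h2
    generalize fA.symm i = s
    rcases s with s | s
    · intro h1; exact absurd s.2 h1
    · intro _ h1; exact absurd s.2 h1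
  · intro b hb
    have := congrFun hg ⟨b, hb⟩
    try dsimp only
    rw [← Finset.sum_add_distrib, ← Finset.sum_add_distrib, ← Finset.sum_add_distrib]
    simp only [← adj_sum]
    rw [Pi.zero_apply] at this
    refine Eq.trans ?_ this
    simp only [Matrix.vecMul, dotProduct, Matrix.map_apply, HM, Matrix.of_apply, H]
    refine Finset.sum_congr rfl fun i _ => ?_
    have e : (-1 : ZMod 2) = 1 := by decide
    simp only [hval]
    split_ifs <;> simp [e]

end HS

theorem odd_holey_square_conjecture (m n : ℕ) (hmn : m < n) :
    ∃ k : ℕ, numTilings (oddHoleySquare m n) = 2 ^ (n - m) * (2 * k + 1) ^ 2 := by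
  have hc := HS.card_Bu hmn
  have fA : HS.WuF (HS.RR m n) ⊕ HS.LAF (HS.RR m n) ≃ HS.BuF (HS.RR m n) :=
    Fintype.equivOfCardEq (by simpa using hc)
  obtain ⟨fB, hB⟩ := HS.exists_fB hmn fA
  have hf := HS.factor (HS.RR_sym m n) fA fB
  rw [HS.RR_coe, HS.card_LA hmn, hB] at hf
  obtain ⟨k, hk⟩ := Int.natAbs_odd.2 (HS.det_odd hmn fA)
  refine ⟨k, ?_⟩
  rw [← Int.natCast_natAbs, hk] at hf
  have : (numTilings (oddHoleySquare m n) : ℤ) =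
      ((2 ^ (n - m) * (2 * k + 1) ^ 2 : ℕ) : ℤ) := by
    rw [hf]; push_cast; ring
  exact_mod_cast this
end

section
/- For all integers m ≥ 1 and n > m, the number of domino tilings of the region H(m,n) is odd. -/
/-- The region `H(m,n)`: the lower half of the holey square cut along the staircase. -/
def Hreg (m n : ℕ) : Set (ℤ × ℤ) :=
  {q | 0 ≤ q.1 ∧ q.1 < 2 * n ∧ 0 ≤ q.2 ∧ q.2 ≤ 2 * (n : ℤ) - 2 - 2 * (q.1 / 2) ∧
    ¬((n : ℤ) - m ≤ q.1 ∧ q.1 < (n : ℤ) + m ∧ (n : ℤ) - m ≤ q.2 ∧ q.2 < (n : ℤ) + m)}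

open Finset in
theorem det_zmod2 {V : Type*} [Fintype V] [DecidableEq V] (r : V → V → Prop)
    [DecidableRel r] (hs : ∀ a b, r a b → r b a) :
    (Matrix.of (fun i j : V => if r i j then (1 : ZMod 2) else 0)).det =
      (Nat.card {σ : Equiv.Perm V // σ⁻¹ = σ ∧ ∀ i, r (σ i) i} : ZMod 2) := by
  classical
  have h1 : ∀ σ : Equiv.Perm V, (((Equiv.Perm.sign σ : ℤˣ) : ℤ) : ZMod 2) = 1 := by
    intro σ
    rcases Int.units_eq_one_or (Equiv.Perm.sign σ) with h | h <;> rw [h] <;> decide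
  rw [Matrix.det_apply']
  simp only [h1, one_mul, Matrix.of_apply]
  have h2 : ∀ σ : Equiv.Perm V, (∏ i, if r (σ i) i then (1 : ZMod 2) else 0)
      = if ∀ i, r (σ i) i then 1 else 0 := by
    intro σ
    rw [Finset.prod_ite_zero]
    simp
  simp only [h2]
  have hinv : ∀ σ : Equiv.Perm V, (∀ i, r (σ i) i) → ∀ i, r (σ⁻¹ i) i := by
    intro σ h i
    have := h (σ⁻¹ i)
    rw [show σ (σ⁻¹ i) = i from σ.apply_symm_apply i] at this
    exact hs _ _ this
  have hinv' : ∀ σ : Equiv.Perm V, (∀ i, r (σ⁻¹ i) i) ↔ (∀ i, r (σ i) i) := by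
    intro σ
    constructor
    · intro h
      simpa using hinv _ h
    · exact hinv σ
  rw [← Finset.sum_filter_add_sum_filter_not univ (fun σ : Equiv.Perm V => σ⁻¹ = σ)]
  have h3 : ∑ σ ∈ univ.filter (fun σ : Equiv.Perm V => ¬ σ⁻¹ = σ),
      (if ∀ i, r (σ i) i then (1 : ZMod 2) else 0) = 0 := by
    apply Finset.sum_involution (fun σ _ => σ⁻¹)
    · intro σ _
      simp only [hinv']
      exact CharTwo.add_self_eq_zero _
    · intro σ hσ _
      simpa using hσ
    · intro σ _
      simp
    · intro σ hσ
      simp only [Finset.mem_filter, mem_univ, true_and, inv_inv] at hσ ⊢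
      exact fun h => hσ h.symm
  rw [h3, add_zero, Finset.sum_boole, Finset.filter_filter, Nat.card_eq_fintype_card,
    Fintype.card_subtype]

theorem adj_symm (a b : ℤ × ℤ) (h : Adjacent a b) : Adjacent b a := by
  unfold Adjacent at *
  omega

theorem adj_ne (a b : ℤ × ℤ) (h : Adjacent a b) : a ≠ b := by
  rintro rfl
  unfold Adjacent at *
  omega

theorem numTilings_eq (R : Set (ℤ × ℤ)) :
    numTilings R = Nat.card {σ : Equiv.Perm R // σ⁻¹ = σ ∧ ∀ i, Adjacent (σ i : ℤ × ℤ) i} := by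
  classical
  symm
  unfold numTilings
  let F : Equiv.Perm R → Set (Set (ℤ × ℤ)) :=
    fun σ => Set.range (fun i : R => ({(i : ℤ × ℤ), (σ i : ℤ × ℤ)} : Set (ℤ × ℤ)))
  have hF : ∀ σ : Equiv.Perm R, (σ⁻¹ = σ ∧ ∀ i, Adjacent (σ i : ℤ × ℤ) i) →
      IsDominoTiling R (F σ) := by
    rintro σ ⟨h1, h2⟩
    have h1' : ∀ i, σ (σ i) = i := by
      intro i
      conv_lhs => rw [← h1]
      conv_lhs => arg 2; rw [h1]
      simp
    refine ⟨?_, ?_, ?_⟩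
    · rintro d ⟨i, rfl⟩
      exact ⟨i, σ i, adj_symm _ _ (h2 i), rfl⟩
    · rintro d ⟨i, rfl⟩ e ⟨j, rfl⟩ hne
      simp only [Function.onFun, id]
      rw [Set.disjoint_left]
      intro a ha hb
      apply hne
      simp only [Set.mem_insert_iff, Set.mem_singleton_iff] at ha hb
      rcases ha with ha | ha <;> rcases hb with hb | hb
      · have : i = j := Subtype.ext (ha ▸ hb)
        rw [this]
      · have : i = σ j := Subtype.ext (ha ▸ hb)
        simp only [this, h1']
        exact Set.pair_comm _ _
      · have : σ i = j := Subtype.ext (ha ▸ hb)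
        simp only [← this, h1']
        exact Set.pair_comm _ _
      · have : σ i = σ j := Subtype.ext (ha ▸ hb)
        rw [σ.injective this]
    · ext a
      constructor
      · rintro ⟨d, ⟨i, rfl⟩, ha⟩
        rcases ha with ha | ha
        · rw [ha]; exact i.2
        · rw [Set.mem_singleton_iff.mp ha]; exact (σ i).2
      · intro ha
        exact ⟨_, ⟨⟨a, ha⟩, rfl⟩, by simp⟩
  refine Nat.card_congr (Equiv.ofBijective (fun σ => ⟨F σ.1, hF σ.1 σ.2⟩) ⟨?_, ?_⟩)
  · rintro ⟨σ, hσ⟩ ⟨τ, hτ⟩ h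
    have hh : F σ = F τ := congrArg Subtype.val h
    apply Subtype.ext
    ext1 i
    have a1 : ({(i : ℤ × ℤ), (σ i : ℤ × ℤ)} : Set (ℤ × ℤ)) ∈ F τ := by
      rw [← hh]; exact ⟨i, rfl⟩
    have a2 : ({(i : ℤ × ℤ), (τ i : ℤ × ℤ)} : Set (ℤ × ℤ)) ∈ F τ := ⟨i, rfl⟩
    have := (hF τ hτ).2.1.elim_set a1 a2 (i : ℤ × ℤ) (by simp) (by simp)
    have h3 : (σ i : ℤ × ℤ) ∈ ({(i : ℤ × ℤ), (τ i : ℤ × ℤ)} : Set (ℤ × ℤ)) := by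
      rw [← this]; simp
    rcases h3 with h3 | h3
    · exact absurd h3 (adj_ne _ _ (hσ.2 i))
    · exact Subtype.ext h3
  · rintro ⟨T, hT1, hT2, hT3⟩
    have key : ∀ i : R, ∃ p : R, Adjacent (i : ℤ × ℤ) p ∧
        ({(i : ℤ × ℤ), (p : ℤ × ℤ)} : Set (ℤ × ℤ)) ∈ T := by
      rintro ⟨i, hi⟩
      have hi' := hi
      rw [← hT3] at hi'
      obtain ⟨d, hd, hid⟩ := hi'
      obtain ⟨a, b, hab, rfl⟩ := hT1 d hd
      have ha : a ∈ R := by rw [← hT3]; exact ⟨_, hd, by simp⟩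
      have hb : b ∈ R := by rw [← hT3]; exact ⟨_, hd, by simp⟩
      rcases hid with h | h
      · subst h
        exact ⟨⟨b, hb⟩, hab, hd⟩
      · have h := Set.mem_singleton_iff.mp h
        subst h
        refine ⟨⟨a, ha⟩, adj_symm _ _ hab, ?_⟩
        rw [Set.pair_comm]; exact hd
    choose p hp1 hp2 using key
    have hpp : Function.Involutive p := by
      intro i
      have := hT2.elim_set (hp2 (p i)) (hp2 i) (p i : ℤ × ℤ) (by simp) (by simp)
      have h3 : (p (p i) : ℤ × ℤ) ∈ ({(i : ℤ × ℤ), (p i : ℤ × ℤ)} : Set (ℤ × ℤ)) := by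
        rw [← this]; simp
      rcases h3 with h3 | h3
      · exact Subtype.ext h3
      · exact absurd h3 (adj_ne _ _ (hp1 (p i))).symm
    refine ⟨⟨hpp.toPerm, ?_, ?_⟩, ?_⟩
    · ext1 i
      rfl
    · intro i
      exact adj_symm _ _ (hp1 i)
    · apply Subtype.ext
      change F hpp.toPerm = T
      ext d
      constructor
      · rintro ⟨i, rfl⟩
        exact hp2 i
      · intro hd
        obtain ⟨a, b, hab, rfl⟩ := hT1 d hd
        have ha : a ∈ R := by rw [← hT3]; exact ⟨_, hd, by simp⟩
        exact ⟨⟨a, ha⟩, hT2.elim_set (hp2 ⟨a, ha⟩) hd a (by simp) (by simp)⟩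

/-- A region whose kernel is trivial has an odd number of tilings. -/
theorem odd_of_kernel (R : Set (ℤ × ℤ)) (hR : R.Finite)
    (h : ∀ f : ℤ → ℤ → ZMod 2, (∀ x y, (x, y) ∉ R → f x y = 0) →
      (∀ x y, (x, y) ∈ R → f (x + 1) y + f (x - 1) y + f x (y + 1) + f x (y - 1) = 0) →
      ∀ x y, f x y = 0) : Odd (numTilings R) := by
  classical
  have : Fintype R := hR.fintype
  rw [numTilings_eq]
  have hd := det_zmod2 (V := R) (fun i j => Adjacent (i : ℤ × ℤ) j)
    (fun a b hab => adj_symm _ _ hab)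
  rw [← ZMod.natCast_ne_zero_iff_odd, ← hd]
  intro h0
  obtain ⟨v, hv, hv0⟩ := Matrix.exists_mulVec_eq_zero_iff.mpr h0
  apply hv
  let f : ℤ → ℤ → ZMod 2 := fun x y => if hx : (x, y) ∈ R then v ⟨(x, y), hx⟩ else 0
  have hf := h f (fun x y hx => by simp [f, hx]) ?_
  · funext ⟨⟨x, y⟩, hx⟩
    have := hf x y
    simpa [f, hx] using this
  · intro x y hxy
    have h1 := congrFun hv0 ⟨(x, y), hxy⟩
    simp only [Matrix.mulVec, dotProduct, Matrix.of_apply, Pi.zero_apply] at h1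
    rw [← h1]
    have hsum : ∀ a b : ℤ, f a b = ∑ j : R, if (j : ℤ × ℤ) = (a, b) then v j else 0 := by
      intro a b
      by_cases hab : (a, b) ∈ R
      · have : ∀ j : R, ((j : ℤ × ℤ) = (a, b)) ↔ j = ⟨(a, b), hab⟩ := by
          intro j; exact ⟨fun h => Subtype.ext h, fun h => by rw [h]⟩
        simp [this, f, hab]
      · simp only [f, hab, dif_neg, not_false_eq_true]
        symm
        apply Finset.sum_eq_zero
        intro j _
        rw [if_neg]
        intro hj
        exact hab (hj ▸ j.2)
    simp only [hsum, ← Finset.sum_add_distrib]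
    apply Finset.sum_congr rfl
    rintro ⟨⟨a, b⟩, hab⟩ _
    by_cases hA : Adjacent (x, y) (a, b)
    · rw [if_pos hA]
      simp only [Adjacent] at hA
      simp only [Prod.mk.injEq]
      split_ifs <;> first | omega | simp
    · rw [if_neg hA]
      simp only [Adjacent] at hA
      simp only [Prod.mk.injEq]
      split_ifs <;> first | omega | simp

/-- The kernel is trivial (shifted coordinates). -/
theorem kernel_trivial (k n : ℤ) (hk : 1 ≤ k) (hkn : k < n) (f : ℤ → ℤ → ZMod 2)
    (R : ℤ → ℤ → Prop)
    (hR : ∀ x y, R x y ↔ (1 ≤ x ∧ 1 ≤ y ∧ (x + y ≤ 2 * n ∨ (x + y = 2 * n + 1 ∧ x % 2 = 0)) ∧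
      (x ≤ k ∨ y ≤ k)))
    (h0 : ∀ x y, ¬ R x y → f x y = 0)
    (h1 : ∀ x y, R x y → f (x + 1) y + f (x - 1) y + f x (y + 1) + f x (y - 1) = 0) :
    ∀ x y, f x y = 0 := by
  obtain ⟨P, hPe, hP⟩ : ∃ P : ℤ → ZMod 2, (∀ i, P (-i) = P i) ∧
      ∀ x : ℤ, 0 ≤ x → f x 1 = P (x + 1) + P (x - 1) := by
    let q : ℕ → ZMod 2 × ZMod 2 := fun j =>
      Nat.rec (0, 0) (fun i r => (r.2, r.1 + f (i + 1) 1)) j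
    have hq : ∀ j : ℕ, (q (j + 2)).1 = (q j).1 + f (j + 1) 1 := fun j => rfl
    refine ⟨fun i => (q i.natAbs).1, fun i => by simp, ?_⟩
    intro x hx
    rcases hx.eq_or_lt with rfl | hx
    · rw [h0 _ _ (by rw [hR]; omega)]
      simp only [zero_add, zero_sub, Int.natAbs_neg]
      exact (CharTwo.add_self_eq_zero _).symm
    · obtain ⟨j, rfl⟩ : ∃ j : ℕ, x = j + 1 := ⟨(x - 1).toNat, by omega⟩
      have e1 : ((j : ℤ) + 1 + 1).natAbs = j + 2 := by omega
      have e2 : ((j : ℤ) + 1 - 1).natAbs = j := by omega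
      simp only [e1, e2, hq]
      linear_combination - CharTwo.add_self_eq_zero (q j).1
  -- bottom strip
  have two : ∀ a : ZMod 2, a + a = 0 := CharTwo.add_self_eq_zero
  have step : ∀ x y, R x y → x + y + 1 ≤ 2 * n → 
      f (x + 1) y = P (x + 1 + y) + P (x + 1 - y) →
      f (x - 1) y = P (x - 1 + y) + P (x - 1 - y) →
      f x (y - 1) = P (x + (y - 1)) + P (x - (y - 1)) →
      f x (y + 1) = P (x + (y + 1)) + P (x - (y + 1)) := by
    intro x y hxy _ ha hb hc
    have := h1 x y hxy
    rw [ha, hb, hc] at this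
    rw [show x + 1 + y = x + (y + 1) by ring, show x + 1 - y = x - (y - 1) by ring,
      show x - 1 + y = x + (y - 1) by ring, show x - 1 - y = x - (y + 1) by ring] at this
    linear_combination this - two (P (x + (y + 1))) - two (P (x - (y - 1)))
      - two (P (x + (y - 1))) - two (P (x - (y + 1)))
  have strip : ∀ j : ℕ, ∀ x, 0 ≤ x → x + j ≤ 2 * n → (j : ℤ) ≤ k + 1 →
      f x j = P (x + j) + P (x - j) := by
    intro j
    induction j using Nat.strong_induction_on with
    | _ j ih =>
      intro x hx hxj hjk
      match j, ih with
      | 0, _ =>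
        rw [h0 _ _ (by rw [hR]; simp)]
        simp [two]
      | 1, _ =>
        simpa using hP x hx
      | j + 2, ih =>
        rcases hx.eq_or_lt with rfl | hx
        · rw [h0 _ _ (by rw [hR]; omega)]
          simp only [zero_add, zero_sub, hPe, two]
        · push_cast at *
          have a := ih (j + 1) (by omega) (x + 1) (by omega) (by push_cast; omega)
            (by push_cast; omega)
          have b := ih (j + 1) (by omega) (x - 1) (by omega) (by push_cast; omega)
            (by push_cast; omega)
          have c := ih j (by omega) x (by omega) (by omega) (by omega)
          push_cast at a b
          have := step x (j + 1) (by rw [hR]; omega) (by omega) a b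
            (by rw [show (j : ℤ) + 1 - 1 = j by ring]; exact c)
          rw [show (j : ℤ) + 1 + 1 = j + 2 by ring] at this
          exact this
  have add0 : ∀ a b : ZMod 2, a + b = 0 → a = b := fun a b => CharTwo.add_eq_zero.mp
  -- periodicity
  have per : ∀ s, 0 ≤ s → s + (2 * k + 2) ≤ 2 * n → P (s + (2 * k + 2)) = P s := by
    intro s hs hsn
    have := strip (k + 1).toNat (s + k + 1) (by omega) (by omega) (by omega)
    rw [h0 _ _ (by rw [hR]; omega), show ((k + 1).toNat : ℤ) = k + 1 by omega] at this
    rw [show s + k + 1 + (k + 1) = s + (2 * k + 2) by ring,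
      show s + k + 1 - (k + 1) = s by ring] at this
    exact add0 _ _ this.symm
  have left : ∀ j : ℕ, ∀ x, 0 ≤ x → x + j ≤ 2 * n → x ≤ k + 1 →
      f x j = P (x + j) + P (x - j) := by
    intro j
    induction j using Nat.strong_induction_on with
    | _ j ih =>
      intro x hx hxj hxk
      by_cases hjk : (j : ℤ) ≤ k + 1
      · exact strip j x hx hxj hjk
      rcases hx.eq_or_lt with rfl | hx
      · rw [h0 _ _ (by rw [hR]; omega)]
        simp only [zero_add, zero_sub, hPe, two]
      rcases hxk.eq_or_lt with rfl | hxk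
      · rw [h0 _ _ (by rw [hR]; omega)]
        rw [← hPe (k + 1 - j)]
        have := per (j - (k + 1)) (by omega) (by omega)
        rw [show (j : ℤ) - (k + 1) + (2 * k + 2) = k + 1 + j by ring] at this
        rw [this, show -(k + 1 - (j : ℤ)) = j - (k + 1) by ring, two]
      · obtain ⟨j, rfl⟩ : ∃ i, j = i + 2 := ⟨j - 2, by omega⟩
        push_cast at *
        have a := ih (j + 1) (by omega) (x + 1) (by omega) (by push_cast; omega) (by omega)
        have b := ih (j + 1) (by omega) (x - 1) (by omega) (by push_cast; omega) (by omega)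
        have c := ih j (by omega) x (by omega) (by omega) (by omega)
        push_cast at a b
        have := step x (j + 1) (by rw [hR]; omega) (by omega) a b
          (by rw [show (j : ℤ) + 1 - 1 = j by ring]; exact c)
        rw [show (j : ℤ) + 1 + 1 = j + 2 by ring] at this
        exact this
  have form : ∀ x y, 0 ≤ x → 0 ≤ y → x + y ≤ 2 * n → (x ≤ k + 1 ∨ y ≤ k + 1) →
      f x y = P (x + y) + P (x - y) := by
    intro x y hx hy hxy h
    obtain ⟨j, rfl⟩ : ∃ j : ℕ, y = j := ⟨y.toNat, by omega⟩
    rcases h with h | h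
    · exact left j x hx hxy h
    · exact strip j x hx hxy h
  -- even links
  have ev0 : ∀ x y, R x y → x + y = 2 * n + 1 → P (x - y - 1) = P (x - y + 1) := by
    intro x y hxy hs
    have := h1 x y hxy
    rw [hR] at hxy
    rw [h0 (x + 1) y (by rw [hR]; omega), h0 x (y + 1) (by rw [hR]; omega),
      form (x - 1) y (by omega) (by omega) (by omega) (by omega),
      form x (y - 1) (by omega) (by omega) (by omega) (by omega),
      show x - 1 + y = x + (y - 1) by ring, show x - 1 - y = x - y - 1 by ring,
      show x - (y - 1) = x - y + 1 by ring] at this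
    apply add0
    linear_combination this - two (P (x + (y - 1)))
  have ev : ∀ t, 1 ≤ t → t ≤ k → P (2 * n - 2 * t) = P (2 * n + 2 - 2 * t) := by
    intro t ht htk
    rcases Int.emod_two_eq_zero_or_one t with h | h
    · have := ev0 t (2 * n + 1 - t) (by rw [hR]; omega) (by omega)
      rw [← hPe, ← hPe (_ + 1)] at this
      rw [show 2 * n - 2 * t = -(t - (2 * n + 1 - t) + 1) by ring, ← this]
      congr 1; ring
    · have := ev0 (2 * n + 1 - t) t (by rw [hR]; omega) (by omega)
      rw [show 2 * n - 2 * t = (2 * n + 1 - t) - t - 1 by ring, this]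
      congr 1; ring
  -- odd links
  have od0 : ∀ x y, R x y → x + y = 2 * n →
      f (x + 1) y + f x (y + 1) = P (x - y - 1) + P (x - y + 1) := by
    intro x y hxy hs
    have := h1 x y hxy
    rw [hR] at hxy
    rw [form (x - 1) y (by omega) (by omega) (by omega) (by omega),
      form x (y - 1) (by omega) (by omega) (by omega) (by omega),
      show x - 1 + y = x + (y - 1) by ring, show x - 1 - y = x - y - 1 by ring,
      show x - (y - 1) = x - y + 1 by ring] at this
    linear_combination this - two (P (x + (y - 1))) - two (P (x - y - 1)) - two (P (x - y + 1))
  have od1 : ∀ x y, R x y → R (x + 1) (y - 1) → x + y = 2 * n → x % 2 = 1 →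
      P (x - y - 1) = P (x - y + 3) := by
    intro x y hxy hxy' hs hx
    have a := od0 x y hxy hs
    have b := od0 (x + 1) (y - 1) hxy' (by omega)
    rw [h0 x (y + 1) (by rw [hR]; omega)] at a
    rw [h0 (x + 1 + 1) (y - 1) (by rw [hR]; omega), show y - 1 + 1 = y by ring,
      show x + 1 - (y - 1) - 1 = x - y + 1 by ring,
      show x + 1 - (y - 1) + 1 = x - y + 3 by ring] at b
    linear_combination b - a
  have od : ∀ t, 1 ≤ t → t + 1 ≤ k → P (2 * n + 1 - 2 * t) = P (2 * n - 3 - 2 * t) := by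
    intro t ht htk
    rcases Int.emod_two_eq_zero_or_one t with h | h
    · have := od1 (2 * n - (t + 1)) (t + 1) (by rw [hR]; omega) (by rw [hR]; omega) (by omega)
        (by omega)
      rw [show 2 * n + 1 - 2 * t = 2 * n - (t + 1) - (t + 1) + 3 by ring, ← this]
      congr 1; ring
    · have := od1 t (2 * n - t) (by rw [hR]; omega) (by rw [hR]; omega) (by omega) h
      rw [← hPe, ← hPe (_ + 3)] at this
      rw [show 2 * n + 1 - 2 * t = -(t - (2 * n - t) - 1) by ring, this]
      congr 1; ring
  have odk : P (2 * n + 1 - 2 * k) = P (2 * n - 1 - 2 * k) := by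
    rcases Int.emod_two_eq_zero_or_one k with h | h
    · have := od0 (2 * n - k) k (by rw [hR]; omega) (by omega)
      rw [h0 _ _ (by rw [hR]; omega), h0 _ _ (by rw [hR]; omega)] at this
      rw [show 2 * n + 1 - 2 * k = 2 * n - k - k + 1 by ring,
        show 2 * n - 1 - 2 * k = 2 * n - k - k - 1 by ring]
      exact (add0 _ _ (by rw [← this]; simp)).symm
    · have := od0 k (2 * n - k) (by rw [hR]; omega) (by omega)
      rw [h0 _ _ (by rw [hR]; omega), h0 _ _ (by rw [hR]; omega)] at this
      rw [← hPe, ← hPe (2 * n - 1 - 2 * k)]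
      rw [show -(2 * n + 1 - 2 * k) = k - (2 * n - k) - 1 by ring,
        show -(2 * n - 1 - 2 * k) = k - (2 * n - k) + 1 by ring]
      exact add0 _ _ (by rw [← this]; simp)
  -- top windows are constant
  have evtop : ∀ j : ℕ, (j : ℤ) ≤ k → P (2 * n - 2 * j) = P (2 * n) := by
    intro j
    induction j with
    | zero => intro _; simp
    | succ j ih =>
      intro hj
      push_cast at hj ⊢
      rw [ev (j + 1) (by omega) hj, ← ih (by omega)]
      congr 1; ring
  have odtop : ∀ j : ℕ, (j : ℤ) ≤ k →
      P (2 * n - 1 - 2 * k + 2 * j) = P (2 * n - 1 - 2 * k) := by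
    intro j
    induction j using Nat.strong_induction_on with
    | _ j ih =>
      intro hj
      match j, ih with
      | 0, _ => simp
      | 1, _ =>
        rw [← odk]; congr 1; push_cast; ring
      | j + 2, ih =>
        rw [← ih j (by omega) (by omega)]
        push_cast at hj ⊢
        have := od (k - j - 1) (by omega) (by omega)
        rw [show 2 * n - 1 - 2 * k + 2 * ((j : ℤ) + 2) = 2 * n + 1 - 2 * (k - j - 1) by ring, this]
        congr 1; ring
  -- all values are constant
  have all : ∀ d : ℕ, ∀ s : ℤ, 0 ≤ s → s = 2 * n - d →
      P s = if s % 2 = 0 then P (2 * n) else P (2 * n - 1 - 2 * k) := by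
    intro d
    induction d using Nat.strong_induction_on with
    | _ d ih =>
      intro s hs hsd
      by_cases hd : s + (2 * k + 2) ≤ 2 * n
      · rw [← per s hs hd, ih (d - (2 * k + 2).toNat) (by omega) _ (by omega) (by omega)]
        have : (s + (2 * k + 2)) % 2 = s % 2 := by omega
        rw [this]
      · split_ifs with h
        · rw [← evtop ((2 * n - s) / 2).toNat (by omega)]
          congr 1; omega
        · rw [← odtop ((s - (2 * n - 1 - 2 * k)) / 2).toNat (by omega)]
          congr 1; omega
  have all' : ∀ s t : ℤ, 0 ≤ s → s ≤ 2 * n → 0 ≤ t → t ≤ 2 * n → s % 2 = t % 2 → P s = P t := by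
    intro s t hs hs' ht ht' hst
    rw [all (2 * n - s).toNat s hs (by omega), all (2 * n - t).toNat t ht (by omega), hst]
  have z1 : ∀ x y, 0 ≤ x → 0 ≤ y → x + y ≤ 2 * n → (x ≤ k + 1 ∨ y ≤ k + 1) → f x y = 0 := by
    intro x y hx hy hxy h
    rw [form x y hx hy hxy h]
    rcases le_total y x with hh | hh
    · rw [all' (x + y) (x - y) (by omega) (by omega) (by omega) (by omega) (by omega), two]
    · rw [← hPe (x - y),
        all' (x + y) (-(x - y)) (by omega) (by omega) (by omega) (by omega) (by omega), two]
  intro x y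
  by_cases hxy : R x y
  · have hxy' := (hR x y).mp hxy
    by_cases hs : x + y ≤ 2 * n
    · exact z1 x y (by omega) (by omega) hs (by omega)
    · have := h1 (x - 1) y (by rw [hR]; omega)
      rw [z1 (x - 1 - 1) y (by omega) (by omega) (by omega) (by omega),
        z1 (x - 1) (y - 1) (by omega) (by omega) (by omega) (by omega),
        h0 (x - 1) (y + 1) (by rw [hR]; omega)] at this
      simpa using this
  · exact h0 x y hxy

theorem Hreg_odd (m n : ℕ) (hm : 1 ≤ m) (hmn : m < n) :
    Odd (numTilings (Hreg m n)) := by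
  apply odd_of_kernel
  · apply Set.Finite.subset (Set.finite_Icc ((0 : ℤ), (0 : ℤ)) (2 * n, 2 * n))
    rintro ⟨x, y⟩ h
    simp only [Hreg, Set.mem_ofPred_eq] at h
    simp only [Set.mem_Icc, Prod.mk_le_mk]
    omega
  · intro f h0 h1 x y
    have := kernel_trivial ((n : ℤ) - m) n (by omega) (by omega) (fun x y => f (x - 1) (y - 1))
      (fun x y => (x - 1, y - 1) ∈ Hreg m n) (by
        intro x y
        simp only [Hreg, Set.mem_ofPred_eq]
        omega)
      (fun x y h => h0 _ _ h)
      (fun x y h => by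
        have := h1 _ _ h
        rw [show x - 1 + 1 = x + 1 - 1 by ring, show y - 1 + 1 = y + 1 - 1 by ring] at this
        exact this) (x + 1) (y + 1)
    simpa using this
end

section
/- For all positive integers k and all integers n ≥ 2, the number of domino tilings of the kn × (k+1)n rectangle N(kn,(k+1)n) has the same parity as the number of domino tilings of the k(n−1) × (k+1)(n−1) rectangle N(k(n−1),(k+1)(n−1)). -/
/-- The `a × b` rectangle of cells `N(a,b)`. -/
def rectN (a b : ℕ) : Set (ℤ × ℤ) :=
  {q | 0 ≤ q.1 ∧ q.1 < a ∧ 0 ≤ q.2 ∧ q.2 < b}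

open Polynomial in
noncomputable def fibP : ℕ → (ZMod 2)[X]
  | 0 => 0
  | 1 => 1
  | (n+2) => Polynomial.X * fibP (n+1) + fibP n

theorem fibP_add (n : ℕ) : ∀ m, fibP (m + n + 1) = fibP (m+1) * fibP (n+1) + fibP m * fibP n := by
  induction n with
  | zero => intro m; simp [fibP]
  | succ n ih =>
    intro m
    have h := ih (m+1)
    rw [show m + (n+1) + 1 = m + 1 + n + 1 by ring, h]
    simp only [fibP]
    ring

theorem fibP_coprime_succ (n : ℕ) : IsCoprime (fibP n) (fibP (n+1)) := by
  induction n with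
  | zero => simp [fibP, isCoprime_one_right]
  | succ n ih =>
    simp only [fibP]
    have := (ih.symm).add_mul_left_right Polynomial.X
    rwa [add_comm (fibP n), mul_comm (fibP (n+1))] at this

theorem fibP_coprime_mul (n k : ℕ) : IsCoprime (fibP (k * (n+1) + 1)) (fibP (n+1)) := by
  induction k with
  | zero => simp [fibP, isCoprime_one_left]
  | succ k ih =>
    have h := fibP_add n (k * (n+1) + 1)
    rw [show (k+1) * (n+1) + 1 = k * (n+1) + 1 + n + 1 by ring, h, add_comm]
    have h2 : IsCoprime (fibP (k * (n+1) + 1) * fibP n) (fibP (n+1)) :=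
      ih.mul_left (fibP_coprime_succ n)
    exact h2.add_mul_right_left _

theorem fibP_coprime_main (n k : ℕ) :
    IsCoprime (fibP (k * (n+1) + 1)) (fibP ((k+1) * (n+1) + 1)) := by
  have h := fibP_add n (k * (n+1) + 1)
  rw [show (k+1) * (n+1) + 1 = k * (n+1) + 1 + n + 1 by ring, h]
  have h2 : IsCoprime (fibP (k * (n+1) + 1)) (fibP (k * (n+1) + 1 + 1) * fibP (n+1)) :=
    (fibP_coprime_succ _).mul_right (fibP_coprime_mul n k)
  exact h2.add_mul_left_right _

def supV (b : ℕ) : Submodule (ZMod 2) (ℤ → ZMod 2) where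
  carrier := {u | ∀ j : ℤ, ¬ (0 ≤ j ∧ j < b) → u j = 0}
  add_mem' := by
    intro u v hu hv j hj
    simp [hu j hj, hv j hj]
  zero_mem' := by intro j _; rfl
  smul_mem' := by
    intro c u hu j hj
    simp [hu j hj]

def pathA (b : ℕ) : supV b →ₗ[ZMod 2] supV b where
  toFun u := ⟨fun j => if 0 ≤ j ∧ j < b then u.1 (j+1) + u.1 (j-1) else 0, by
    intro j hj
    simp only [if_neg hj]⟩
  map_add' := by
    intro u v
    ext j
    simp only [Submodule.coe_add, Pi.add_apply]
    split_ifs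
    · ring
    · simp
  map_smul' := by
    intro c u
    ext j
    simp only [Submodule.coe_smul, Pi.smul_apply, smul_eq_mul, RingHom.id_apply]
    split_ifs
    · ring
    · simp

theorem zmod2_aux {x y z : ZMod 2} (h : x + y = z) : x = z + y := by
  revert x y z; decide

theorem zmod2_aux4 : ∀ (x y z t : ZMod 2), x + y + z + t = 0 → x = z + t + y := by
  decide

theorem coord_eq (b : ℕ) (m : ℕ) : ∀ (u : supV b),
    (m ≤ b → u.1 (m:ℤ) = (Polynomial.aeval (pathA b) (fibP (m+1)) u).1 0) ∧
    (m + 1 ≤ b → u.1 ((m:ℤ)+1) = (Polynomial.aeval (pathA b) (fibP (m+2)) u).1 0) := by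
  induction m with
  | zero =>
    intro u
    refine ⟨fun _ => by simp [fibP], fun h => ?_⟩
    simp only [fibP]
    have h1 : (0:ℤ) < b := by exact_mod_cast h
    have h2 : u.1 (-1) = 0 := u.2 (-1) (by omega)
    simp [pathA, h2]
    omega
  | succ m ih =>
    intro u
    refine ⟨fun h => ?_, fun h => ?_⟩
    · have := (ih u).2 h
      simpa using this
    · have h1 := (ih (pathA b u)).2 (by omega)
      have h2 := (ih u).1 (by omega)
      have h3 : (pathA b u).1 ((m:ℤ)+1) = u.1 ((m:ℤ)+1+1) + u.1 (m:ℤ) := by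
        simp only [pathA, LinearMap.coe_mk, AddHom.coe_mk]
        rw [if_pos (by omega)]
        simp
      rw [show fibP (m+1+2) = fibP (m+2) * Polynomial.X + fibP (m+1) by
        simp only [fibP]; ring]
      simp only [map_add, map_mul, Polynomial.aeval_X, LinearMap.add_apply, Submodule.coe_add,
        Pi.add_apply, Module.End.mul_apply]
      rw [← h1, ← h2]
      push_cast
      exact zmod2_aux h3.symm

theorem ann_path (b : ℕ) (u : supV b) : Polynomial.aeval (pathA b) (fibP (b+1)) u = 0 := by
  have key : ∀ u : supV b, (Polynomial.aeval (pathA b) (fibP (b+1)) u).1 0 = 0 := by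
    intro u
    rw [← (coord_eq b b u).1 le_rfl]
    exact u.2 _ (by omega)
  ext j
  by_cases hj : 0 ≤ j ∧ j < b
  · obtain ⟨m, rfl⟩ := Int.eq_ofNat_of_zero_le hj.1
    rw [(coord_eq b m _).1 (by omega), ← Module.End.mul_apply, ← map_mul, mul_comm, map_mul,
      Module.End.mul_apply]
    exact key _
  · exact (Polynomial.aeval (pathA b) (fibP (b+1)) u).2 j hj

/-- Discrete harmonic functions vanish. -/
theorem harm_vanish (a b : ℕ) (hc : IsCoprime (fibP (a+1)) (fibP (b+1)))
    (w : ℤ → ℤ → ZMod 2) (hw : ∀ i j : ℤ, ¬ (0 ≤ i ∧ i < a ∧ 0 ≤ j ∧ j < b) → w i j = 0)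
    (hh : ∀ i j : ℤ, (0 ≤ i ∧ i < a ∧ 0 ≤ j ∧ j < b) →
      w (i+1) j + w (i-1) j + w i (j+1) + w i (j-1) = 0) : ∀ i j, w i j = 0 := by
  let r : ℤ → supV b := fun i => ⟨w i, fun j hj => hw i j (by tauto)⟩
  have hrec : ∀ i : ℤ, 0 ≤ i → i < a → r (i+1) = pathA b (r i) + r (i-1) := by
    intro i h0 h1
    ext j
    simp only [r, pathA, LinearMap.coe_mk, AddHom.coe_mk, Submodule.coe_add, Pi.add_apply]
    split_ifs with hj
    · have := hh i j ⟨h0, h1, hj⟩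
      exact zmod2_aux4 _ _ _ _ this
    · rw [hw _ _ (by tauto), hw _ _ (by tauto)]; simp
  have hr : ∀ m : ℕ, (m ≤ a → r m = Polynomial.aeval (pathA b) (fibP (m+1)) (r 0)) ∧
      (m + 1 ≤ a → r (m+1) = Polynomial.aeval (pathA b) (fibP (m+2)) (r 0)) := by
    intro m
    induction m with
    | zero =>
      refine ⟨fun _ => by simp [fibP], fun h => ?_⟩
      have h1 := hrec 0 le_rfl (by omega)
      have h2 : r (0-1) = 0 := by
        ext j
        exact hw _ _ (by omega)
      rw [h2] at h1
      simp only [fibP]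
      simpa using h1
    | succ m ih =>
      refine ⟨fun h => by simpa using ih.2 h, fun h => ?_⟩
      have h1 := hrec (m+1) (by omega) (by omega)
      have h2 := ih.2 (by omega)
      have h3 := ih.1 (by omega)
      rw [show ((m:ℤ)+1-1) = m by ring, h2, h3] at h1
      push_cast
      rw [h1, show fibP (m+1+2) = Polynomial.X * fibP (m+2) + fibP (m+1) by simp only [fibP]]
      simp only [map_add, map_mul, Polynomial.aeval_X, LinearMap.add_apply, Module.End.mul_apply]
  have ha : Polynomial.aeval (pathA b) (fibP (a+1)) (r 0) = 0 := by
    rw [← (hr a).1 le_rfl]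
    ext j
    exact hw _ _ (by omega)
  have hb := ann_path b (r 0)
  have h0 : r 0 = 0 := by
    obtain ⟨p, q, hpq⟩ := hc
    have : Polynomial.aeval (pathA b) (p * fibP (a+1) + q * fibP (b+1)) (r 0) = r 0 := by
      rw [hpq]; simp
    rw [← this]
    simp only [map_add, map_mul, LinearMap.add_apply, Module.End.mul_apply, ha, hb, map_zero,
      add_zero]
  intro i j
  by_cases hi : 0 ≤ i ∧ i < a
  · obtain ⟨m, rfl⟩ := Int.eq_ofNat_of_zero_le hi.1
    have := (hr m).1 (by omega)
    rw [h0, map_zero] at this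
    exact congrFun (congrArg Subtype.val this) j
  · exact hw _ _ (by tauto)

theorem Adjacent.symm' {x y : ℤ × ℤ} (h : Adjacent x y) : Adjacent y x := by
  unfold Adjacent at *; omega

theorem Adjacent.ne' {x y : ℤ × ℤ} (h : Adjacent x y) : x ≠ y := by
  rintro rfl
  unfold Adjacent at h; omega

/-- Tilings correspond to involutions moving each cell to a neighbour. -/
theorem tilings_card (R : Set (ℤ × ℤ)) :
    numTilings R = Nat.card {σ : Equiv.Perm R // σ⁻¹ = σ ∧ ∀ x : R, Adjacent (σ x) x} := by
  symm
  have inv : ∀ σ : Equiv.Perm R, σ⁻¹ = σ → ∀ x, σ (σ x) = x := by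
    intro σ h x
    nth_rewrite 1 [← h]
    simp
  refine Nat.card_eq_of_bijective (fun σ => ⟨{d | ∃ x : R, d = {x.1, (σ.1 x).1}}, ?_, ?_, ?_⟩) ⟨?_, ?_⟩
  · rintro d ⟨x, rfl⟩
    exact ⟨_, _, (σ.2.2 x).symm', rfl⟩
  · rintro d ⟨x, rfl⟩ e ⟨y, rfl⟩ hne
    have hi := inv σ.1 σ.2.1
    simp only [Function.onFun, id]
    rw [Set.disjoint_left]
    intro z hz hz'
    apply hne
    simp only [Set.mem_insert_iff, Set.mem_singleton_iff] at hz hz'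
    rcases hz with rfl | rfl <;> rcases hz' with h | h
    · rw [Subtype.ext h]
    · have := Subtype.ext h
      subst this
      rw [hi, Set.pair_comm]
    · have := Subtype.ext h
      subst this
      rw [hi, Set.pair_comm]
    · have := σ.1.injective (Subtype.ext h)
      rw [this]
  · ext z
    simp only [Set.mem_sUnion, Set.mem_ofPred_eq]
    constructor
    · rintro ⟨d, ⟨x, rfl⟩, hz⟩
      rcases hz with rfl | hz
      · exact x.2
      · rw [Set.mem_singleton_iff.1 hz]; exact (σ.1 x).2
    · intro hz
      exact ⟨_, ⟨⟨z, hz⟩, rfl⟩, by simp⟩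
  · intro σ τ h
    have h := congrArg Subtype.val h
    simp only at h
    apply Subtype.ext
    ext1 x
    have hx : ({x.1, (σ.1 x).1} : Set (ℤ × ℤ)) ∈ {d : Set (ℤ × ℤ) | ∃ x : R, d = {x.1, (τ.1 x).1}} := by
      rw [← h]; exact ⟨x, rfl⟩
    obtain ⟨y, hy⟩ := hx
    have h1 : x.1 ∈ ({y.1, (τ.1 y).1} : Set (ℤ × ℤ)) := by rw [← hy]; simp
    have h2 : (σ.1 x).1 ∈ ({y.1, (τ.1 y).1} : Set (ℤ × ℤ)) := by rw [← hy]; simp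
    have h3 : (σ.1 x).1 ≠ x.1 := (σ.2.2 x).ne'
    simp only [Set.mem_insert_iff, Set.mem_singleton_iff] at h1 h2
    rcases h1 with h1 | h1
    · have e := Subtype.ext h1
      subst e
      rcases h2 with h2 | h2
      · exact absurd h2 h3
      · exact Subtype.ext h2
    · have e := Subtype.ext h1
      have e2 : τ.1 x = y := by rw [e, inv τ.1 τ.2.1]
      rcases h2 with h2 | h2
      · rw [e2]; exact Subtype.ext h2
      · exact absurd (h2.trans h1.symm) h3
  · rintro ⟨T, hT1, hT2, hT3⟩
    have ex : ∀ x : R, ∃ y : R, ({x.1, y.1} : Set (ℤ × ℤ)) ∈ T ∧ Adjacent y.1 x.1 := by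
      intro x
      have hx : x.1 ∈ ⋃₀ T := hT3.symm ▸ x.2
      obtain ⟨d, hd, hxd⟩ := hx
      obtain ⟨p, q, hpq, rfl⟩ := hT1 d hd
      have hp : p ∈ R := by rw [← hT3]; exact ⟨_, hd, by simp⟩
      have hq : q ∈ R := by rw [← hT3]; exact ⟨_, hd, by simp⟩
      rcases hxd with h | h
      · exact ⟨⟨q, hq⟩, by rw [h]; exact hd, by rw [h]; exact hpq.symm'⟩
      · rw [Set.mem_singleton_iff] at h
        exact ⟨⟨p, hp⟩, by rw [h, Set.pair_comm]; exact hd, by rw [h]; exact hpq⟩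
    choose g hg hga using ex
    have uniq : ∀ d ∈ T, ∀ e ∈ T, ∀ z, z ∈ d → z ∈ e → d = e := by
      intro d hd e he z h1 h2
      by_contra hne
      exact Set.disjoint_left.1 (hT2 hd he hne) h1 h2
    have gg : ∀ x, g (g x) = x := by
      intro x
      have h := uniq _ (hg x) _ (hg (g x)) (g x).1 (by simp) (by simp)
      have h1 : x.1 ∈ ({(g x).1, (g (g x)).1} : Set (ℤ × ℤ)) := by rw [← h]; simp
      rcases h1 with h1 | h1
      · exact absurd h1.symm (hga x).ne'
      · exact (Subtype.ext h1).symm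
    refine ⟨⟨⟨g, g, gg, gg⟩, ?_, ?_⟩, ?_⟩
    · rfl
    · exact hga
    · apply Subtype.ext
      ext d
      simp only [Set.mem_ofPred_eq, Equiv.coe_fn_mk]
      constructor
      · rintro ⟨x, rfl⟩; exact hg x
      · intro hd
        obtain ⟨p, q, hpq, rfl⟩ := hT1 d hd
        have hp : p ∈ R := by rw [← hT3]; exact ⟨_, hd, by simp⟩
        exact ⟨⟨p, hp⟩, uniq _ hd _ (hg ⟨p, hp⟩) p (by simp) (by simp)⟩

open Classical in
theorem det_card (R : Set (ℤ × ℤ)) [Fintype R] :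
    (Matrix.of (fun x y : R => if Adjacent x y then (1 : ZMod 2) else 0)).det
      = (numTilings R : ZMod 2) := by
  rw [tilings_card, Nat.card_eq_fintype_card, Fintype.card_subtype, Matrix.det_apply]
  have h1 : ∀ σ : Equiv.Perm R, Equiv.Perm.sign σ • ∏ i, (Matrix.of (fun x y : R => if Adjacent x y then (1 : ZMod 2) else 0)) (σ i) i = if ∀ x : R, Adjacent (σ x) x then 1 else 0 := by
    intro σ
    have hs : ∀ z : ZMod 2, Equiv.Perm.sign σ • z = z := by
      intro z
      rcases Int.units_eq_one_or (Equiv.Perm.sign σ) with h | h <;> rw [h]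
      · simp
      · rw [Units.neg_smul, one_smul]; revert z; decide
    rw [hs]
    simp only [Matrix.of_apply]
    rw [Finset.prod_ite_zero]
    simp
  rw [Finset.sum_congr rfl (fun σ _ => h1 σ)]
  rw [← Finset.sum_filter_add_sum_filter_not Finset.univ (fun σ : Equiv.Perm R => σ⁻¹ = σ)]
  have h2 : ∑ σ ∈ Finset.univ.filter (fun σ : Equiv.Perm R => ¬ σ⁻¹ = σ),
      (if ∀ x : R, Adjacent (σ x) x then (1 : ZMod 2) else 0) = 0 := by
    refine Finset.sum_involution (fun σ _ => σ⁻¹) ?_ ?_ ?_ ?_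
    · intro σ _
      have : (∀ x : R, Adjacent (σ⁻¹ x) x) ↔ ∀ x : R, Adjacent (σ x) x := by
        constructor
        · intro h x
          have := h (σ x)
          rw [show σ⁻¹ (σ x) = x by simp] at this
          exact this.symm'
        · intro h x
          have := h (σ⁻¹ x)
          rw [show σ (σ⁻¹ x) = x by simp] at this
          exact this.symm'
      simp only [this]
      split_ifs <;> decide
    · intro σ hσ _
      exact (Finset.mem_filter.1 hσ).2
    · intro σ hσ
      simp only [Finset.mem_filter, Finset.mem_univ, true_and, inv_inv] at hσ ⊢
      exact fun h => hσ h.symm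
    · intro σ _
      simp
  rw [h2, add_zero, ← Finset.sum_filter, Finset.filter_filter]
  simp

open Classical in
theorem odd_of_coprime (a b : ℕ) (hc : IsCoprime (fibP (a+1)) (fibP (b+1))) :
    numTilings (rectN a b) % 2 = 1 := by
  have hfin : (rectN a b).Finite := by
    refine ((Set.finite_Ico (0:ℤ) a).prod (Set.finite_Ico (0:ℤ) b)).subset ?_
    rintro q ⟨h1, h2, h3, h4⟩
    exact ⟨⟨h1, h2⟩, ⟨h3, h4⟩⟩
  haveI : Fintype (rectN a b) := hfin.fintype
  have hdet := det_card (rectN a b)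
  by_contra hne
  have h0 : (numTilings (rectN a b) : ZMod 2) = 0 := by
    rw [ZMod.natCast_eq_zero_iff]; omega
  rw [h0, ← Matrix.exists_mulVec_eq_zero_iff] at hdet
  obtain ⟨v, hv, hv0⟩ := hdet
  apply hv
  let w : ℤ → ℤ → ZMod 2 := fun i j => if h : (i, j) ∈ rectN a b then v ⟨(i, j), h⟩ else 0
  have hz := harm_vanish a b hc w (fun i j h => dif_neg h) (by
    intro i j hij
    have := congrFun hv0 ⟨(i, j), hij⟩
    simp only [Matrix.mulVec, dotProduct, Matrix.of_apply, Pi.zero_apply] at this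
    rw [← this]
    have e : ∀ p q : ℤ, w p q = ∑ y : rectN a b, if y.1 = (p, q) then v y else 0 := by
      intro p q
      by_cases h : (p, q) ∈ rectN a b
      · simp only [w, dif_pos h]
        rw [Finset.sum_eq_single ⟨(p, q), h⟩]
        · simp
        · intro y _ hy
          rw [if_neg]
          intro h'
          exact hy (Subtype.ext h')
        · simp
      · simp only [w, dif_neg h]
        rw [Finset.sum_eq_zero]
        intro y _
        rw [if_neg]
        intro h'
        exact h (h' ▸ y.2)
    simp only [e, ← Finset.sum_add_distrib]
    refine Finset.sum_congr rfl fun y _ => ?_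
    obtain ⟨⟨p, q⟩, hy⟩ := y
    simp only [Adjacent, Prod.mk.injEq]
    generalize v ⟨(p, q), hy⟩ = z
    by_cases h1 : p = i + 1 ∧ q = j
    · obtain ⟨rfl, rfl⟩ := h1
      simp; omega
    by_cases h2 : p = i - 1 ∧ q = j
    · obtain ⟨rfl, rfl⟩ := h2
      simp; omega
    by_cases h3 : p = i ∧ q = j + 1
    · obtain ⟨rfl, rfl⟩ := h3
      simp; omega
    by_cases h4 : p = i ∧ q = j - 1
    · obtain ⟨rfl, rfl⟩ := h4
      simp; omega
    rw [if_neg h1, if_neg h2, if_neg h3, if_neg h4]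
    have h5 : ¬ (i = p ∧ (j = q + 1 ∨ q = j + 1) ∨ j = q ∧ (i = p + 1 ∨ p = i + 1)) := by omega
    simp only [h5, if_false]
    simp)
  ext ⟨⟨p, q⟩, hy⟩
  have := hz p q
  simp only [w, dif_pos hy] at this
  exact this

theorem rect_kn_parity_reduction (k n : ℕ) (hk : 0 < k) (hn : 2 ≤ n) :
    numTilings (rectN (k * n) ((k + 1) * n)) % 2 =
      numTilings (rectN (k * (n - 1)) ((k + 1) * (n - 1))) % 2 := by
  obtain ⟨m, rfl⟩ : ∃ m, n = m + 2 := ⟨n - 2, by omega⟩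
  rw [odd_of_coprime _ _ (fibP_coprime_main (m+1) k)]
  exact (odd_of_coprime _ _ (fibP_coprime_main m k)).symm
end

section
/- For all positive integers k and p, the number of domino tilings of the region T(k,k,p) is even. -/
/-- The region `T(i,j,p)`: rows `r = 0, …, i+p-2` from top to bottom of lengths
`j, j+2, …, j+2(p-2)` followed by `i` rows of length `j+2(p-1)`, centers aligned. -/
def Treg (i j p : ℕ) : Set (ℤ × ℤ) :=
  {q | 0 ≤ q.2 ∧ q.2 ≤ (i : ℤ) + p - 2 ∧
    (p : ℤ) - 1 - min q.2 ((p : ℤ) - 1) ≤ q.1 ∧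
    q.1 ≤ (p : ℤ) - 2 + j + min q.2 ((p : ℤ) - 1)}

namespace TKK

def sc (p i : ℕ) : ℤ × ℤ := ((p : ℤ) - 1 + i, (i : ℤ))
def uc (p i : ℕ) : ℤ × ℤ := ((p : ℤ) + i, (i : ℤ))
def lc (p i : ℕ) : ℤ × ℤ := ((p : ℤ) - 1 + i, (i : ℤ) + 1)

def Blk (p : ℕ) (T : Set (Set (ℤ × ℤ))) (i : ℕ) : Prop :=
  (({sc p i, uc p i} : Set (ℤ × ℤ)) ∈ T ∧ ({sc p (i+1), lc p i} : Set (ℤ × ℤ)) ∈ T) ∨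
  (({sc p i, lc p i} : Set (ℤ × ℤ)) ∈ T ∧ ({sc p (i+1), uc p i} : Set (ℤ × ℤ)) ∈ T)

def sw (p i : ℕ) : Equiv.Perm (ℤ × ℤ) := Equiv.swap (uc p i) (lc p i)

/-- the tiling transported by the swap -/
def flp (p i : ℕ) (T : Set (Set (ℤ × ℤ))) : Set (Set (ℤ × ℤ)) := {d | sw p i '' d ∈ T}

lemma sw_s (p i j : ℕ) : sw p i (sc p j) = sc p j := by
  apply Equiv.swap_apply_of_ne_of_ne <;> simp only [sc, uc, lc, ne_eq, Prod.mk.injEq] <;> omega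

lemma sw_u (p i j : ℕ) (h : j ≠ i) : sw p i (uc p j) = uc p j := by
  apply Equiv.swap_apply_of_ne_of_ne <;> simp only [uc, lc, ne_eq, Prod.mk.injEq] <;> omega

lemma sw_l (p i j : ℕ) (h : j ≠ i) : sw p i (lc p j) = lc p j := by
  apply Equiv.swap_apply_of_ne_of_ne <;> simp only [uc, lc, ne_eq, Prod.mk.injEq] <;> omega

lemma sw_u' (p i : ℕ) : sw p i (uc p i) = lc p i := Equiv.swap_apply_left _ _
lemma sw_l' (p i : ℕ) : sw p i (lc p i) = uc p i := Equiv.swap_apply_right _ _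

lemma sw_sw (p i : ℕ) (d : Set (ℤ × ℤ)) : sw p i '' (sw p i '' d) = d := by
  rw [Set.image_image]; simp [sw]

lemma flp_flp (p i : ℕ) (T) : flp p i (flp p i T) = T := by
  ext d; simp only [flp, Set.mem_ofPred_eq, sw_sw]

lemma blk_flp (p i j : ℕ) (T) : Blk p (flp p i T) j ↔ Blk p T j := by
  by_cases h : j = i
  · subst h
    simp only [Blk, flp, Set.mem_ofPred_eq, Set.image_pair, sw_s, sw_u', sw_l']
    exact or_comm
  · simp only [Blk, flp, Set.mem_ofPred_eq, Set.image_pair, sw_s, sw_u p i j h, sw_l p i j h]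

lemma uniq {R T} (hT : IsDominoTiling R T) {d e : Set (ℤ × ℤ)} (hd : d ∈ T) (he : e ∈ T)
    {x} (hx : x ∈ d) (hy : x ∈ e) : d = e := by
  by_contra hne
  exact Set.disjoint_left.1 (hT.2.1 hd he hne) hx hy

lemma pair_inj {α} {a b c : α} (h : ({a, b} : Set α) = {a, c}) : b = c := by
  have h1 : b ∈ ({a, c} : Set α) := h ▸ (by simp)
  have h2 : c ∈ ({a, b} : Set α) := h ▸ (by simp)
  simp only [Set.mem_insert_iff, Set.mem_singleton_iff] at h1 h2
  rcases h1 with h1 | h1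
  · rcases h2 with h2 | h2
    · rw [h1, h2]
    · exact h2.symm
  · exact h1

lemma u_ne_l (p i : ℕ) : uc p i ≠ lc p i := by
  simp only [uc, lc, ne_eq, Prod.mk.injEq]; omega

lemma flp_ne {R T} (hT : IsDominoTiling R T) (p i : ℕ) (h : Blk p T i) : flp p i T ≠ T := by
  intro he
  have key : ∀ x y, ({sc p i, x} : Set (ℤ × ℤ)) ∈ T → sw p i x = y → x ≠ y → False := by
    intro x y hx hxy hne
    have h2 := hx
    rw [← he] at h2
    simp only [flp, Set.mem_ofPred_eq, Set.image_pair, sw_s, hxy] at h2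
    exact hne (pair_inj (uniq hT hx h2 (x := sc p i) (by simp) (by simp)))
  rcases h with h | h
  · exact key _ _ h.1 (sw_u' p i) (u_ne_l p i)
  · exact key _ _ h.1 (sw_l' p i) (u_ne_l p i).symm

lemma flp_tiling {R T} (hT : IsDominoTiling R T) (p i : ℕ) (h : Blk p T i) :
    IsDominoTiling R (flp p i T) := by
  -- the dominoes through `uc` and `lc`
  obtain ⟨x, y, hx, hy, hxa, hya, hxs, hys⟩ : ∃ x y, ({x, uc p i} : Set (ℤ × ℤ)) ∈ T ∧
      ({y, lc p i} : Set (ℤ × ℤ)) ∈ T ∧ Adjacent x (lc p i) ∧ Adjacent y (uc p i) ∧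
      sw p i x = x ∧ sw p i y = y := by
    rcases h with h | h
    · refine ⟨_, _, h.1, h.2, ?_, ?_, sw_s .., sw_s ..⟩ <;>
        simp only [Adjacent, sc, uc, lc, Nat.cast_add, Nat.cast_one, true_and, true_or, or_true, and_true] <;> omega
    · refine ⟨_, _, h.2, h.1, ?_, ?_, sw_s .., sw_s ..⟩ <;>
        simp only [Adjacent, sc, uc, lc, Nat.cast_add, Nat.cast_one, true_and, true_or, or_true, and_true] <;> omega
  have hu : uc p i ∈ R := by rw [← hT.2.2]; exact ⟨_, hx, by simp⟩
  have hl : lc p i ∈ R := by rw [← hT.2.2]; exact ⟨_, hy, by simp⟩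
  refine ⟨?_, ?_, ?_⟩
  · intro d hd
    have hd' : sw p i '' d ∈ T := hd
    by_cases h1 : uc p i ∈ sw p i '' d
    · have := uniq hT hd' hx h1 (by simp)
      refine ⟨x, lc p i, hxa, ?_⟩
      rw [← sw_sw p i d, this, Set.image_pair, hxs, sw_u']
    by_cases h2 : lc p i ∈ sw p i '' d
    · have := uniq hT hd' hy h2 (by simp)
      refine ⟨y, uc p i, hya, ?_⟩
      rw [← sw_sw p i d, this, Set.image_pair, hys, sw_l']
    · obtain ⟨a, b, hab, he⟩ := hT.1 _ hd'
      refine ⟨a, b, hab, ?_⟩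
      rw [he] at h1 h2
      simp only [Set.mem_insert_iff, Set.mem_singleton_iff, not_or] at h1 h2
      rw [← sw_sw p i d, he, Set.image_pair]
      congr 1
      · exact Equiv.swap_apply_of_ne_of_ne (Ne.symm h1.1) (Ne.symm h2.1)
      · congr 1
        exact Equiv.swap_apply_of_ne_of_ne (Ne.symm h1.2) (Ne.symm h2.2)
  · intro d hd e he hne
    have hne' : sw p i '' d ≠ sw p i '' e := fun hh =>
      hne ((sw p i).injective.image_injective hh)
    have := hT.2.1 hd he hne'
    exact (Set.disjoint_image_iff (sw p i).injective).1 this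
  · have hR : ∀ z, sw p i z ∈ R ↔ z ∈ R := by
      intro z
      by_cases h1 : z = uc p i
      · subst h1; rw [sw_u']; exact ⟨fun _ => hu, fun _ => hl⟩
      by_cases h2 : z = lc p i
      · subst h2; rw [sw_l']; exact ⟨fun _ => hl, fun _ => hu⟩
      rw [sw, Equiv.swap_apply_of_ne_of_ne h1 h2]
    ext z
    rw [← hR z, ← hT.2.2]
    constructor
    · rintro ⟨d, hd, hz⟩
      exact ⟨_, hd, ⟨z, hz, rfl⟩⟩
    · rintro ⟨d, hd, hz⟩
      refine ⟨sw p i '' d, ?_, ⟨_, hz, ?_⟩⟩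
      · show sw p i '' (sw p i '' d) ∈ T
        rwa [sw_sw]
      · simp [sw]

lemma nbr {R T} (hT : IsDominoTiling R T) {x} (hx : x ∈ R) :
    ∃ y ∈ R, Adjacent x y ∧ ({x, y} : Set (ℤ × ℤ)) ∈ T := by
  have hx' := hx
  rw [← hT.2.2] at hx'
  obtain ⟨d, hd, hxd⟩ := hx'
  obtain ⟨a, b, hab, rfl⟩ := hT.1 d hd
  rcases hxd with h | h
  · subst h
    exact ⟨b, by rw [← hT.2.2]; exact ⟨_, hd, by simp⟩, hab, hd⟩
  · have h : x = b := h
    subst h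
    refine ⟨a, by rw [← hT.2.2]; exact ⟨_, hd, by simp⟩, ?_, by rwa [Set.pair_comm]⟩
    unfold Adjacent at *; omega

lemma exists_blk (k p : ℕ) (hk : 0 < k) (hp : 0 < p) {T} (hT : IsDominoTiling (Treg k k p) T) :
    ∃ i, Blk p T i := by
  by_contra hno
  push Not at hno
  have hs : ∀ i, i ≤ k + p - 2 → sc p i ∈ Treg k k p := by
    intro i hi
    simp only [Treg, sc, Set.mem_ofPred_eq]; omega
  have F : ∀ i, i ≤ k + p - 2 → ({sc p i, uc p i} : Set (ℤ × ℤ)) ∈ T ∨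
      ({sc p i, lc p i} : Set (ℤ × ℤ)) ∈ T := by
    intro i
    induction i with
    | zero =>
      intro hi
      obtain ⟨⟨c, r⟩, hy, ha, hd⟩ := nbr hT (hs 0 hi)
      have : (c, r) = uc p 0 ∨ (c, r) = lc p 0 := by
        simp only [Treg, sc, uc, lc, Adjacent, Set.mem_ofPred_eq, Prod.mk.injEq] at *
        omega
      rcases this with h | h <;> rw [h] at hd
      · exact Or.inl hd
      · exact Or.inr hd
    | succ i ih =>
      intro hi
      have ih := ih (by omega)
      obtain ⟨⟨c, r⟩, hy, ha, hd⟩ := nbr hT (hs (i+1) hi)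
      have : (c, r) = uc p (i+1) ∨ (c, r) = lc p (i+1) ∨ (c, r) = uc p i ∨ (c, r) = lc p i := by
        clear hno ih hs hd
        simp only [sc, uc, lc, Adjacent, Prod.mk.injEq] at *
        push_cast at *
        omega
      have hne : sc p i ≠ sc p (i+1) := by
        simp only [sc, ne_eq, Prod.mk.injEq]; omega
      have key : ∀ x, ({sc p i, x} : Set (ℤ × ℤ)) ∈ T → ({sc p (i+1), x} : Set (ℤ × ℤ)) ∈ T →
          False := by
        intro x h1 h2
        have := uniq hT h1 h2 (x := x) (by simp) (by simp)
        rw [Set.pair_comm, Set.pair_comm (sc p (i+1))] at this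
        exact hne (pair_inj this)
      rcases this with h | h | h | h <;> rw [h] at hd
      · exact Or.inl hd
      · exact Or.inr hd
      · rcases ih with h1 | h1
        · exact (key _ h1 hd).elim
        · exact (hno i (Or.inr ⟨h1, hd⟩)).elim
      · rcases ih with h1 | h1
        · exact (hno i (Or.inl ⟨h1, hd⟩)).elim
        · exact (key _ h1 hd).elim
  rcases F (k + p - 2) le_rfl with h | h
  · have : uc p (k + p - 2) ∈ Treg k k p := by rw [← hT.2.2]; exact ⟨_, h, by simp⟩
    simp only [Treg, uc, Set.mem_ofPred_eq] at this; omega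
  · have : lc p (k + p - 2) ∈ Treg k k p := by rw [← hT.2.2]; exact ⟨_, h, by simp⟩
    simp only [Treg, lc, Set.mem_ofPred_eq] at this; omega

lemma even_of_invol {α : Type*} (g : α → α) (hg : ∀ x, g (g x) = x) (hf : ∀ x, g x ≠ x) :
    Even (Nat.card α) := by
  rcases finite_or_infinite α with h | h
  · have := Fintype.ofFinite α
    rw [Nat.card_eq_fintype_card, ← ZMod.natCast_eq_zero_iff_even]
    have : ∑ x : α, (1 : ZMod 2) = 0 :=
      Finset.sum_involution (fun x _ => g x) (fun _ _ => by decide) (fun x _ _ => hf x)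
        (fun _ _ => Finset.mem_univ _) (fun x _ => hg x)
    simpa using this
  · simp

end TKK

open Classical in
theorem TKK.main (k p : ℕ) (hk : 0 < k) (hp : 0 < p) :
    Even (numTilings (Treg k k p)) := by
  have hex : ∀ T : {T // IsDominoTiling (Treg k k p) T}, ∃ i, TKK.Blk p T.1 i :=
    fun T => TKK.exists_blk k p hk hp T.2
  let ix : {T // IsDominoTiling (Treg k k p) T} → ℕ := fun T => Nat.find (hex T)
  let g : {T // IsDominoTiling (Treg k k p) T} → {T // IsDominoTiling (Treg k k p) T} :=
    fun T => ⟨TKK.flp p (ix T) T.1, TKK.flp_tiling T.2 p _ (Nat.find_spec (hex T))⟩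
  have hix : ∀ T, ix (g T) = ix T := by
    intro T
    apply Nat.find_congr'
    intro n
    exact TKK.blk_flp p _ n _
  refine TKK.even_of_invol g ?_ ?_
  · intro T
    apply Subtype.ext
    show TKK.flp p (ix (g T)) (TKK.flp p (ix T) T.1) = T.1
    rw [hix, TKK.flp_flp]
  · intro T h
    exact TKK.flp_ne T.2 p (ix T) (Nat.find_spec (hex T)) (congrArg Subtype.val h)

theorem T_k_k_even (k p : ℕ) (hk : 0 < k) (hp : 0 < p) :
    Even (numTilings (Treg k k p)) := by
  exact TKK.main k p hk hp
end
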